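/- arXiv:1801.01924 — 3 statements merged into one kernel-verified Lean document; each statement's English description precedes it below -/
import Mathlib

section
/- Theorem 3.1. Assume the block Jacobi operator J is self-adjoint and bounded from below, let b ∈ ℝ be such that there exists a compact self-adjoint operator K₀ on H with ⟨(J−K₀)u,u⟩ ≥ b‖u‖² for all u ∈ dom J (i.e. the essential spectrum of J lies in [b,∞)), fix δ > 0 and ε ∈ (0,1), and let λ ∈ ℂ satisfy Re λ < b and λ ∉ σ(J). Then there is a constant C, independent of j and k, such that for all j,k ∈ ℕ: ‖G_{jk}(λ)‖_{B(K)} ≤ C·exp(−γ(λ)·Σ_{m=min(j,k)}^{max(j,k)−1} φ_δ(‖A_m‖_{B(K)})). -/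
noncomputable section

open scoped InnerProductSpace ENNReal

/-- The function `ψ(x) = x² eˣ`. -/
def psiFun (x : ℝ) : ℝ := x ^ 2 * Real.exp x

/-- The inverse function of `ψ` on `[0,∞)`. -/
def psiInv (t : ℝ) : ℝ := sInf {x : ℝ | 0 ≤ x ∧ psiFun x = t}

/-- The function `φ_δ`: `1/√δ` on `[0,δ)` and `1/√x` on `[δ,∞)`. -/
def phiFun (δ x : ℝ) : ℝ := if x < δ then 1 / Real.sqrt δ else 1 / Real.sqrt x

/-- `γ(λ) = √δ · ψ⁻¹((b − Re λ)(1−ε)/δ)`. -/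
def gammaFun (δ ε b relam : ℝ) : ℝ := Real.sqrt δ * psiInv ((b - relam) * (1 - ε) / δ)

variable {K : Type*} [NormedAddCommGroup K] [InnerProductSpace ℂ K] [CompleteSpace K]

/-- A sequence in `ℓ²(ℕ,K)` is finitely supported. -/
def IsFinSupp (u : lp (fun _ : ℕ => K) 2) : Prop := Set.Finite {n | u n ≠ 0}

/-- The formal block Jacobi action (indices starting at `0`):
`(Υu)₀ = B₀u₀ + A₀u₁` and `(Υu)_{k+1} = A*_k u_k + B_{k+1} u_{k+1} + A_{k+1} u_{k+2}`. -/
def jacApply (A B : ℕ → K →L[ℂ] K) (v : ℕ → K) : ℕ → K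
  | 0 => B 0 (v 0) + A 0 (v 1)
  | k + 1 =>
      ContinuousLinearMap.adjoint (A k) (v k) + B (k + 1) (v (k + 1)) + A (k + 1) (v (k + 2))

/-- `J` is the block Jacobi operator with entries `A`, `B`: every finitely supported sequence
belongs to its domain, it acts on those by the block Jacobi difference expression, and it is
the closure of its restriction to the finitely supported sequences (i.e. its graph is contained
in the closure of the graph of `J₀`). -/
structure IsBlockJacobi (J : lp (fun _ : ℕ => K) 2 →ₗ.[ℂ] lp (fun _ : ℕ => K) 2)
    (A B : ℕ → K →L[ℂ] K) : Prop where
  dom_fin : ∀ u : lp (fun _ : ℕ => K) 2, IsFinSupp u → u ∈ J.domain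
  apply_fin : ∀ (u : lp (fun _ : ℕ => K) 2) (hu : u ∈ J.domain), IsFinSupp u →
    ∀ n, (J ⟨u, hu⟩) n = jacApply A B (fun m => u m) n
  isClosure : ∀ u : J.domain, ((u : lp (fun _ : ℕ => K) 2), J u) ∈
    closure {p : lp (fun _ : ℕ => K) 2 × lp (fun _ : ℕ => K) 2 |
      ∃ h1 : p.1 ∈ J.domain, IsFinSupp p.1 ∧ J ⟨p.1, h1⟩ = p.2}

/-- `R` is an everywhere-defined bounded inverse of `J − λI`; the existence of such an `R`
says precisely that `λ ∉ σ(J)`. -/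
def IsResolventAt (J : lp (fun _ : ℕ => K) 2 →ₗ.[ℂ] lp (fun _ : ℕ => K) 2) (lam : ℂ)
    (R : lp (fun _ : ℕ => K) 2 →L[ℂ] lp (fun _ : ℕ => K) 2) : Prop :=
  (∀ u : J.domain, R (J u - lam • (u : lp (fun _ : ℕ => K) 2)) = u) ∧
  (∀ v : lp (fun _ : ℕ => K) 2, ∃ hv : R v ∈ J.domain, J ⟨R v, hv⟩ - lam • (R v) = v)

/-- `J` is bounded from below. -/
def IsBoundedBelowOp (J : lp (fun _ : ℕ => K) 2 →ₗ.[ℂ] lp (fun _ : ℕ => K) 2) : Prop :=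
  ∃ c : ℝ, ∀ u : J.domain,
    c * ‖(u : lp (fun _ : ℕ => K) 2)‖ ^ 2 ≤ (⟪J u, (u : lp (fun _ : ℕ => K) 2)⟫_ℂ).re

/-- The essential spectrum of `J` lies in `[b,∞)`: there is a compact self-adjoint operator `K₀`
with `⟨(J−K₀)u,u⟩ ≥ b‖u‖²` on the domain of `J`. -/
def EssSpecFrom (J : lp (fun _ : ℕ => K) 2 →ₗ.[ℂ] lp (fun _ : ℕ => K) 2) (b : ℝ) : Prop :=
  ∃ K₀ : lp (fun _ : ℕ => K) 2 →L[ℂ] lp (fun _ : ℕ => K) 2,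
    IsCompactOperator K₀ ∧ IsSelfAdjoint K₀ ∧
    ∀ u : J.domain, b * ‖(u : lp (fun _ : ℕ => K) 2)‖ ^ 2 ≤
      (⟪J u - K₀ (u : lp (fun _ : ℕ => K) 2), (u : lp (fun _ : ℕ => K) 2)⟫_ℂ).re

set_option linter.unusedSectionVars false

lemma psiInv_spec {t : ℝ} (ht : 0 ≤ t) : 0 ≤ psiInv t ∧ psiFun (psiInv t) = t := by
  have hcont : Continuous psiFun := by unfold psiFun; fun_prop
  have hne : {x : ℝ | 0 ≤ x ∧ psiFun x = t}.Nonempty := by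
    have hivt := intermediate_value_Icc (a := 0) (b := t + 1) (by linarith) hcont.continuousOn
    have hmem : t ∈ Set.Icc (psiFun 0) (psiFun (t + 1)) := by
      refine ⟨by simpa [psiFun] using ht, ?_⟩
      have h1 : 1 ≤ Real.exp (t + 1) := Real.one_le_exp (by linarith)
      unfold psiFun
      nlinarith [sq_nonneg t, sq_nonneg (t + 1)]
    obtain ⟨x, hx, hxt⟩ := hivt hmem
    exact ⟨x, hx.1, hxt⟩
  have hclosed : IsClosed {x : ℝ | 0 ≤ x ∧ psiFun x = t} :=
    (isClosed_le continuous_const continuous_id).inter (isClosed_eq hcont continuous_const)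
  exact hclosed.csInf_mem hne ⟨0, fun x hx => hx.1⟩

lemma phiFun_nonneg (δ x : ℝ) : 0 ≤ phiFun δ x := by
  unfold phiFun; split_ifs <;> positivity

lemma mul_sq_exp_phiFun_le {δ a x : ℝ} (hδ : 0 < δ) (hx : 0 ≤ x) :
    a * ((√δ * x * phiFun δ a) ^ 2 * Real.exp (√δ * x * phiFun δ a)) ≤ δ * psiFun x := by
  have hsδ : 0 < √δ := Real.sqrt_pos.2 hδ
  unfold phiFun psiFun
  split_ifs with h
  · have hd : √δ * x * (1 / √δ) = x := by field_simp
    rw [hd]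
    gcongr
  · push Not at h
    have ha' : 0 < a := hδ.trans_le h
    have hsa : 0 < √a := Real.sqrt_pos.2 ha'
    have hd : √δ * x * (1 / √a) ≤ x := by
      rw [mul_one_div, div_le_iff₀ hsa, mul_comm]
      exact mul_le_mul_of_nonneg_left (Real.sqrt_le_sqrt h) hx
    have hsq : a * (√δ * x * (1 / √a)) ^ 2 = δ * x ^ 2 := by
      rw [mul_pow, mul_pow, div_pow, Real.sq_sqrt hδ.le, Real.sq_sqrt ha'.le]
      field_simp
    rw [← mul_assoc, hsq, mul_assoc]
    gcongr

lemma exp_add_exp_neg_sub_two_nonneg (d : ℝ) : 0 ≤ Real.exp d + Real.exp (-d) - 2 := by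
  have h := Real.one_le_cosh d
  rw [Real.cosh_eq] at h
  linarith

lemma exp_add_exp_neg_sub_two_le {d : ℝ} (hd : 0 ≤ d) :
    Real.exp d + Real.exp (-d) - 2 ≤ d ^ 2 * Real.exp d := by
  have h1 : Real.exp d * Real.exp (-d) = 1 := by rw [← Real.exp_add]; simp
  have h2 : 1 - d ≤ Real.exp (-d) := by linarith [Real.add_one_le_exp (-d)]
  have h3 : Real.exp (-d) ≤ 1 := Real.exp_le_one_iff.2 (by linarith)
  have h4 : (1 - Real.exp (-d)) ^ 2 ≤ d ^ 2 := pow_le_pow_left₀ (by linarith) (by linarith) 2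
  have h5 : Real.exp d + Real.exp (-d) - 2 = (1 - Real.exp (-d)) ^ 2 * Real.exp d := by
    linear_combination (2 - Real.exp (-d)) * h1
  rw [h5]
  gcongr

/-- Conjugating the block Jacobi action by an exponential weight lowers the quadratic form by at
most `κ` times the squared norm. -/
lemma sum_re_inner_jacApply_weighted_ge (A B : ℕ → K →L[ℂ] K) {d E : ℕ → ℝ} {κ : ℝ}
    (hd : ∀ n, 0 ≤ d n) (hκ : ∀ n, ‖A n‖ * (d n ^ 2 * Real.exp (d n)) ≤ κ)
    (hE : ∀ n, E (n + 1) = Real.exp (d n) * E n) (w : ℕ → K) {N : ℕ} (hw : ∀ n, N ≤ n → w n = 0) :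
    ∑ n ∈ Finset.range (N + 1),
        (⟪jacApply A B (fun m => (E m : ℂ) • w m) n, (E n : ℂ) • w n⟫_ℂ).re
      - κ * ∑ n ∈ Finset.range (N + 1), ‖(E n : ℂ) • w n‖ ^ 2
      ≤ ∑ n ∈ Finset.range (N + 1), (⟪(E n : ℂ) • jacApply A B w n, (E n : ℂ) • w n⟫_ℂ).re := by
  set z : ℕ → K := fun m => (E m : ℂ) • w m with hz
  have hzN : z N = 0 := by simp [hz, hw N le_rfl]
  set c : ℕ → ℝ := fun n => (⟪A n (z (n + 1)), z n⟫_ℂ).re with hc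
  have hcN : c N = 0 := by simp [hc, hzN]
  have hup : ∀ n, (E n : ℂ) • A n (w (n + 1)) = (Real.exp (-d n) : ℂ) • A n (z (n + 1)) := by
    intro n
    simp only [hz, map_smul, smul_smul, hE n]
    congr 1
    have : Real.exp (-d n) * Real.exp (d n) = 1 := by rw [← Real.exp_add]; simp
    norm_cast
    rw [← mul_assoc, this, one_mul]
  have hlow : ∀ n, (⟪(E (n + 1) : ℂ) • ContinuousLinearMap.adjoint (A n) (w n), z (n + 1)⟫_ℂ).re
      = Real.exp (d n) * c n := by
    intro n
    have : (E (n + 1) : ℂ) • ContinuousLinearMap.adjoint (A n) (w n)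
        = (Real.exp (d n) : ℂ) • ContinuousLinearMap.adjoint (A n) (z n) := by
      simp only [hz, map_smul, smul_smul, hE n]
      push_cast
      rfl
    rw [this, inner_smul_left, ContinuousLinearMap.adjoint_inner_left, Complex.conj_ofReal,
      Complex.re_ofReal_mul, ← inner_conj_symm, Complex.conj_re]
  have hlow' : ∀ n, (⟪ContinuousLinearMap.adjoint (A n) (z n), z (n + 1)⟫_ℂ).re = c n := by
    intro n
    rw [ContinuousLinearMap.adjoint_inner_left, ← inner_conj_symm, Complex.conj_re]
  have hsum : ∀ M, ∑ n ∈ Finset.range (M + 1), ((⟪(E n : ℂ) • jacApply A B w n, z n⟫_ℂ).re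
      - (⟪jacApply A B z n, z n⟫_ℂ).re)
      = ∑ n ∈ Finset.range M, (Real.exp (d n) + Real.exp (-d n) - 2) * c n
        + (Real.exp (-d M) - 1) * c M := by
    intro M
    induction M with
    | zero =>
      have hB0 : (E 0 : ℂ) • B 0 (w 0) = B 0 (z 0) := by simp [hz]
      have h2 := hup 0
      simp only [zero_add] at h2
      simp only [zero_add, Finset.range_one, Finset.sum_singleton, Finset.range_zero,
        Finset.sum_empty, jacApply, smul_add, h2, hB0, inner_add_left, Complex.add_re]
      simp only [inner_smul_left, Complex.conj_ofReal, Complex.re_ofReal_mul, hc, zero_add]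
      ring
    | succ M ih =>
      have hBM : (E (M + 1) : ℂ) • B (M + 1) (w (M + 1)) = B (M + 1) (z (M + 1)) := by simp [hz]
      have h2 := hup (M + 1)
      rw [Finset.sum_range_succ, ih, Finset.sum_range_succ]
      simp only [jacApply, smul_add, inner_add_left, Complex.add_re, hlow, hlow', hBM, h2]
      simp only [inner_smul_left, Complex.conj_ofReal, Complex.re_ofReal_mul, hc]
      ring
  have hterm : ∀ n, -(κ / 2) * (‖z n‖ ^ 2 + ‖z (n + 1)‖ ^ 2)
      ≤ (Real.exp (d n) + Real.exp (-d n) - 2) * c n := by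
    intro n
    have h0 := exp_add_exp_neg_sub_two_nonneg (d n)
    have h1 := exp_add_exp_neg_sub_two_le (hd n)
    have hcn : |c n| ≤ ‖A n‖ * (‖z (n + 1)‖ * ‖z n‖) := by
      refine (Complex.abs_re_le_norm _).trans ((norm_inner_le_norm _ _).trans ?_)
      rw [← mul_assoc]
      gcongr
      exact (A n).le_opNorm _
    have h2 : (Real.exp (d n) + Real.exp (-d n) - 2) * |c n|
        ≤ κ * (‖z (n + 1)‖ * ‖z n‖) := by
      calc _ ≤ (d n ^ 2 * Real.exp (d n)) * (‖A n‖ * (‖z (n + 1)‖ * ‖z n‖)) := by gcongr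
        _ = ‖A n‖ * (d n ^ 2 * Real.exp (d n)) * (‖z (n + 1)‖ * ‖z n‖) := by ring
        _ ≤ _ := by gcongr; exact hκ n
    have hκ0 : 0 ≤ κ := le_trans (by positivity) (hκ n)
    have h3 := mul_le_mul_of_nonneg_left (neg_abs_le (c n)) h0
    nlinarith [mul_nonneg hκ0 (sq_nonneg (‖z n‖ - ‖z (n + 1)‖))]
  have hκ0 : 0 ≤ κ := le_trans (by positivity) (hκ 0)
  have hfin : -κ * ∑ n ∈ Finset.range (N + 1), ‖z n‖ ^ 2
      ≤ ∑ n ∈ Finset.range N, (Real.exp (d n) + Real.exp (-d n) - 2) * c n := by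
    refine le_trans ?_ (Finset.sum_le_sum fun n _ => hterm n)
    rw [← Finset.mul_sum, Finset.sum_add_distrib]
    have e1 := Finset.sum_range_succ (fun n => ‖z n‖ ^ 2) N
    have e2 := Finset.sum_range_succ' (fun n => ‖z n‖ ^ 2) N
    have := sq_nonneg ‖z N‖
    have := sq_nonneg ‖z 0‖
    nlinarith
  have hM := hsum N
  rw [hcN, mul_zero, add_zero, Finset.sum_sub_distrib] at hM
  linarith

lemma lp_inner_eq_sum_range (f g : lp (fun _ : ℕ => K) 2) {N : ℕ} (hg : ∀ n, N ≤ n → g n = 0) :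
    ⟪f, g⟫_ℂ = ∑ n ∈ Finset.range N, ⟪f n, g n⟫_ℂ := by
  rw [lp.inner_eq_tsum]
  refine tsum_eq_sum fun n hn => ?_
  rw [hg n (by simpa using hn), inner_zero_right]

lemma lp_norm_sq_eq_sum_range (g : lp (fun _ : ℕ => K) 2) {N : ℕ} (hg : ∀ n, N ≤ n → g n = 0) :
    ‖g‖ ^ 2 = ∑ n ∈ Finset.range N, ‖g n‖ ^ 2 := by
  have h := congrArg Complex.re (lp_inner_eq_sum_range g g hg)
  rw [Complex.re_sum] at h
  rw [← inner_self_eq_norm_sq (𝕜 := ℂ)]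
  refine h.trans (Finset.sum_congr rfl fun n _ => ?_)
  rw [← inner_self_eq_norm_sq (𝕜 := ℂ)]
  rfl

/-- Multiplication by a bounded scalar weight on `ℓ²(ℕ,K)`. -/
def weightOp (E : ℕ → ℝ) {C : ℝ} (hC : 0 ≤ C) (hE : ∀ n, |E n| ≤ C) :
    lp (fun _ : ℕ => K) 2 →L[ℂ] lp (fun _ : ℕ => K) 2 :=
  lp.mapCLM 2 (fun n => (E n : ℂ) • ContinuousLinearMap.id ℂ K) hC fun n =>
    ContinuousLinearMap.opNorm_le_bound _ hC fun x => by
      rw [smul_apply, norm_smul, Complex.norm_real]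
      exact mul_le_mul_of_nonneg_right (hE n) (norm_nonneg x)

@[simp]
lemma weightOp_apply (E : ℕ → ℝ) {C : ℝ} (hC : 0 ≤ C) (hE : ∀ n, |E n| ≤ C)
    (u : lp (fun _ : ℕ => K) 2) (n : ℕ) : weightOp E hC hE u n = (E n : ℂ) • u n :=
  rfl

lemma IsFinSupp.exists_eq_zero {u : lp (fun _ : ℕ => K) 2} (hu : IsFinSupp u) :
    ∃ N, ∀ n, N ≤ n → u n = 0 := by
  obtain ⟨M, hM⟩ := Set.Finite.bddAbove hu
  refine ⟨M + 1, fun n hn => ?_⟩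
  by_contra h
  exact absurd (hM (show n ∈ {n | u n ≠ 0} from h)) (by omega)

lemma IsBlockJacobi.weighted_energy_ge_of_isFinSupp {A B : ℕ → K →L[ℂ] K}
    {J : lp (fun _ : ℕ => K) 2 →ₗ.[ℂ] lp (fun _ : ℕ => K) 2} (hJ : IsBlockJacobi J A B)
    {b : ℝ} {K₀ : lp (fun _ : ℕ => K) 2 →L[ℂ] lp (fun _ : ℕ => K) 2}
    (hb : ∀ u : J.domain, b * ‖(u : lp (fun _ : ℕ => K) 2)‖ ^ 2 ≤
      (⟪J u - K₀ (u : lp (fun _ : ℕ => K) 2), (u : lp (fun _ : ℕ => K) 2)⟫_ℂ).re)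
    {d E : ℕ → ℝ} {κ : ℝ} (hd : ∀ n, 0 ≤ d n)
    (hκ : ∀ n, ‖A n‖ * (d n ^ 2 * Real.exp (d n)) ≤ κ)
    (hE : ∀ n, E (n + 1) = Real.exp (d n) * E n)
    {W : lp (fun _ : ℕ => K) 2 →L[ℂ] lp (fun _ : ℕ => K) 2}
    (hW : ∀ (u : lp (fun _ : ℕ => K) 2) (n : ℕ), W u n = (E n : ℂ) • u n)
    {w : lp (fun _ : ℕ => K) 2} (hwJ : w ∈ J.domain) (hfin : IsFinSupp w) :
    (b - κ) * ‖W w‖ ^ 2 ≤ (⟪W (J ⟨w, hwJ⟩), W w⟫_ℂ).re - (⟪K₀ (W w), W w⟫_ℂ).re := by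
  obtain ⟨N, hN⟩ := hfin.exists_eq_zero
  have hWN : ∀ n, N ≤ n → (W w) n = 0 := fun n hn => by rw [hW, hN n hn, smul_zero]
  have hWN' : ∀ n, N + 1 ≤ n → (W w) n = 0 := fun n hn => hWN n (by omega)
  have hWfin : IsFinSupp (W w) := by
    refine (Set.finite_lt_nat N).subset fun n hn => ?_
    by_contra h
    exact hn (hWN n (by simpa using h))
  have hWJ := hJ.dom_fin _ hWfin
  have hWw : (fun m => W w m) = fun m => (E m : ℂ) • w m := funext (hW w)
  have h1 := hb ⟨W w, hWJ⟩
  have h2 := sum_re_inner_jacApply_weighted_ge A B hd hκ hE (fun n => w n) hN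
  have e1 : (⟪J ⟨W w, hWJ⟩, W w⟫_ℂ).re = ∑ n ∈ Finset.range (N + 1),
      (⟪jacApply A B (fun m => (E m : ℂ) • w m) n, (E n : ℂ) • w n⟫_ℂ).re := by
    rw [lp_inner_eq_sum_range _ _ hWN', Complex.re_sum]
    refine Finset.sum_congr rfl fun n _ => ?_
    rw [hJ.apply_fin _ hWJ hWfin, hWw, hW]
  have e2 : (⟪W (J ⟨w, hwJ⟩), W w⟫_ℂ).re = ∑ n ∈ Finset.range (N + 1),
      (⟪(E n : ℂ) • jacApply A B (fun m => w m) n, (E n : ℂ) • w n⟫_ℂ).re := by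
    rw [lp_inner_eq_sum_range _ _ hWN', Complex.re_sum]
    refine Finset.sum_congr rfl fun n _ => ?_
    rw [hW, hW, hJ.apply_fin _ hwJ hfin]
  have e3 : ‖W w‖ ^ 2 = ∑ n ∈ Finset.range (N + 1), ‖(E n : ℂ) • w n‖ ^ 2 := by
    rw [lp_norm_sq_eq_sum_range _ hWN']
    exact Finset.sum_congr rfl fun n _ => by rw [hW]
  rw [← e1, ← e2, ← e3] at h2
  rw [inner_sub_left, Complex.sub_re] at h1
  linarith

/-- Agmon-type energy estimate for the exponentially weighted block Jacobi operator. -/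
lemma IsBlockJacobi.weighted_energy_ge {A B : ℕ → K →L[ℂ] K}
    {J : lp (fun _ : ℕ => K) 2 →ₗ.[ℂ] lp (fun _ : ℕ => K) 2} (hJ : IsBlockJacobi J A B)
    {b : ℝ} {K₀ : lp (fun _ : ℕ => K) 2 →L[ℂ] lp (fun _ : ℕ => K) 2}
    (hb : ∀ u : J.domain, b * ‖(u : lp (fun _ : ℕ => K) 2)‖ ^ 2 ≤
      (⟪J u - K₀ (u : lp (fun _ : ℕ => K) 2), (u : lp (fun _ : ℕ => K) 2)⟫_ℂ).re)
    {d E : ℕ → ℝ} {κ : ℝ} (hd : ∀ n, 0 ≤ d n)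
    (hκ : ∀ n, ‖A n‖ * (d n ^ 2 * Real.exp (d n)) ≤ κ)
    (hE : ∀ n, E (n + 1) = Real.exp (d n) * E n)
    {W : lp (fun _ : ℕ => K) 2 →L[ℂ] lp (fun _ : ℕ => K) 2}
    (hW : ∀ (u : lp (fun _ : ℕ => K) 2) (n : ℕ), W u n = (E n : ℂ) • u n) (u : J.domain) :
    (b - κ) * ‖W (u : lp (fun _ : ℕ => K) 2)‖ ^ 2 ≤
      (⟪W (J u), W (u : lp (fun _ : ℕ => K) 2)⟫_ℂ).re
      - (⟪K₀ (W (u : lp (fun _ : ℕ => K) 2)), W (u : lp (fun _ : ℕ => K) 2)⟫_ℂ).re := by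
  have hclosed : IsClosed {p : lp (fun _ : ℕ => K) 2 × lp (fun _ : ℕ => K) 2 |
      (b - κ) * ‖W p.1‖ ^ 2 ≤ (⟪W p.2, W p.1⟫_ℂ).re - (⟪K₀ (W p.1), W p.1⟫_ℂ).re} := by
    refine isClosed_le (by fun_prop) ?_
    refine Continuous.sub (Complex.continuous_re.comp ?_) (Complex.continuous_re.comp ?_)
    · exact Continuous.inner (by fun_prop) (by fun_prop)
    · exact Continuous.inner (by fun_prop) (by fun_prop)
  have hsub : {p : lp (fun _ : ℕ => K) 2 × lp (fun _ : ℕ => K) 2 |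
      ∃ h1 : p.1 ∈ J.domain, IsFinSupp p.1 ∧ J ⟨p.1, h1⟩ = p.2} ⊆
      {p | (b - κ) * ‖W p.1‖ ^ 2 ≤ (⟪W p.2, W p.1⟫_ℂ).re - (⟪K₀ (W p.1), W p.1⟫_ℂ).re} := by
    rintro p ⟨hp, hfin, hpJ⟩
    have h := hJ.weighted_energy_ge_of_isFinSupp hb hd hκ hE hW hp hfin
    rw [hpJ] at h
    exact h
  have hmem := closure_minimal hsub hclosed (hJ.isClosure u)
  rw [Set.mem_ofPred_eq] at hmem
  exact hmem

lemma norm_sub_sum_single_le (w : lp (fun _ : ℕ => K) 2) (N : ℕ) :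
    ‖w - ∑ m ∈ Finset.range N, lp.single 2 m (w m)‖ ≤ ‖w‖ := by
  refine lp.norm_mono (by norm_num) fun i => ?_
  rw [lp.coeFn_sub, Pi.sub_apply, lp.coeFn_sum, Finset.sum_apply]
  by_cases hi : i < N <;> simp [Finset.sum_pi_single, hi]

/-- The tails of vectors in the range of a compact operator are uniformly small. -/
lemma IsCompactOperator.exists_tail_le {K₀ : lp (fun _ : ℕ => K) 2 →L[ℂ] lp (fun _ : ℕ => K) 2}
    (hK : IsCompactOperator K₀) {η : ℝ} (hη : 0 < η) :
    ∃ N : ℕ, ∀ v : lp (fun _ : ℕ => K) 2,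
      ‖K₀ v - ∑ m ∈ Finset.range N, lp.single 2 m (K₀ v m)‖ ≤ η * ‖v‖ := by
  obtain ⟨S, hS, hSK⟩ := IsCompactOperator.image_closedBall_subset_compact
    (f := (K₀ : lp (fun _ : ℕ => K) 2 →ₗ[ℂ] lp (fun _ : ℕ => K) 2)) hK 1
  obtain ⟨t, ht, hcov⟩ := Metric.totallyBounded_iff.1 hS.totallyBounded (η / 2) (half_pos hη)
  have hev : ∀ᶠ N in Filter.atTop, ∀ y ∈ t,
      ‖y - ∑ m ∈ Finset.range N, lp.single 2 m (y m)‖ < η / 2 := by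
    rw [Filter.eventually_all_finite ht]
    intro y _
    have := (lp.hasSum_single (p := 2) (by norm_num) y).tendsto_sum_nat
    have := (tendsto_const_nhds (x := y)).sub this
    rw [sub_self] at this
    have := this.norm
    rw [norm_zero] at this
    exact this.eventually_lt_const (half_pos hη)
  obtain ⟨N, hN⟩ := hev.exists
  refine ⟨N, ?_⟩
  have hball : ∀ v : lp (fun _ : ℕ => K) 2, ‖v‖ ≤ 1 →
      ‖K₀ v - ∑ m ∈ Finset.range N, lp.single 2 m (K₀ v m)‖ ≤ η := by
    intro v hv
    have hmem := hcov (hSK ⟨v, by simpa using hv, rfl⟩)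
    simp only [Set.mem_iUnion, Metric.mem_ball, dist_eq_norm] at hmem
    obtain ⟨y, hyt, hy⟩ := hmem
    have hy' : ‖K₀ v - y‖ < η / 2 := hy
    have hdecomp : K₀ v - ∑ m ∈ Finset.range N, lp.single 2 m (K₀ v m)
        = ((K₀ v - y) - ∑ m ∈ Finset.range N, lp.single 2 m ((K₀ v - y) m))
          + (y - ∑ m ∈ Finset.range N, lp.single 2 m (y m)) := by
      simp only [lp.coeFn_sub, Pi.sub_apply, lp.single_sub, Finset.sum_sub_distrib]
      abel
    rw [hdecomp]
    have h1 := norm_sub_sum_single_le (K₀ v - y) N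
    have h2 := hN y hyt
    exact (norm_add_le _ _).trans (by linarith)
  intro v
  by_cases hv : v = 0
  · subst hv; simp
  have hvn : 0 < ‖v‖ := norm_pos_iff.2 hv
  have hb := hball (((‖v‖⁻¹ : ℝ) : ℂ) • v) (by
    rw [norm_smul, Complex.norm_real, norm_inv, norm_norm, inv_mul_cancel₀ hvn.ne'])
  simp only [map_smul, lp.coeFn_smul, Pi.smul_apply, lp.single_smul, ← Finset.smul_sum,
    ← smul_sub] at hb
  rw [norm_smul, Complex.norm_real, norm_inv, norm_norm, inv_mul_le_iff₀ hvn] at hb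
  linarith

lemma IsCompactOperator.exists_neg_re_inner_le
    {K₀ : lp (fun _ : ℕ => K) 2 →L[ℂ] lp (fun _ : ℕ => K) 2}
    (hK : IsCompactOperator K₀) {η : ℝ} (hη : 0 < η) :
    ∃ N : ℕ, ∀ v : lp (fun _ : ℕ => K) 2,
      -(⟪K₀ v, v⟫_ℂ).re ≤ η * ‖v‖ ^ 2 + ‖K₀‖ * ‖v‖ * ∑ m ∈ Finset.range N, ‖v m‖ := by
  obtain ⟨N, hN⟩ := hK.exists_tail_le hη
  refine ⟨N, fun v => ?_⟩
  set T := ∑ m ∈ Finset.range N, lp.single (E := fun _ : ℕ => K) 2 m (K₀ v m) with hT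
  have hsplit : ⟪K₀ v, v⟫_ℂ = ⟪K₀ v - T, v⟫_ℂ + ⟪T, v⟫_ℂ := by
    rw [← inner_add_left, sub_add_cancel]
  have h1 : ‖⟪K₀ v - T, v⟫_ℂ‖ ≤ η * ‖v‖ ^ 2 := by
    refine (norm_inner_le_norm _ _).trans ?_
    have := mul_le_mul_of_nonneg_right (hN v) (norm_nonneg v)
    linarith [this]
  have h2 : ‖⟪T, v⟫_ℂ‖ ≤ ‖K₀‖ * ‖v‖ * ∑ m ∈ Finset.range N, ‖v m‖ := by
    rw [hT, sum_inner, Finset.mul_sum]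
    refine (norm_sum_le _ _).trans (Finset.sum_le_sum fun m _ => ?_)
    rw [lp.inner_single_left]
    refine (norm_inner_le_norm _ _).trans ?_
    gcongr
    exact (lp.norm_apply_le_norm (by norm_num) _ m).trans (K₀.le_opNorm v)
  have h3 := (neg_le_abs _).trans (Complex.abs_re_le_norm ⟪K₀ v, v⟫_ℂ)
  rw [hsplit] at h3 ⊢
  linarith [norm_add_le ⟪K₀ v - T, v⟫_ℂ ⟪T, v⟫_ℂ]

/-- The adjoint of the resolvent of a self-adjoint operator at `λ` maps into the domain and is a
right inverse at `conj λ`. -/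
lemma IsResolventAt.adjoint_mem_domain {J : lp (fun _ : ℕ => K) 2 →ₗ.[ℂ] lp (fun _ : ℕ => K) 2}
    (hsa : IsSelfAdjoint J) {lam : ℂ} {R : lp (fun _ : ℕ => K) 2 →L[ℂ] lp (fun _ : ℕ => K) 2}
    (hR : IsResolventAt J lam R) (v : lp (fun _ : ℕ => K) 2) :
    ∃ hv : ContinuousLinearMap.adjoint R v ∈ J.domain,
      J ⟨ContinuousLinearMap.adjoint R v, hv⟩
        - (starRingEnd ℂ lam) • ContinuousLinearMap.adjoint R v = v := by
  have hJ : LinearPMap.adjoint J = J := hsa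
  have hform : ∀ u : J.domain,
      ⟪v + (starRingEnd ℂ lam) • ContinuousLinearMap.adjoint R v, (u : lp (fun _ : ℕ => K) 2)⟫_ℂ
        = ⟪ContinuousLinearMap.adjoint R v, J u⟫_ℂ := by
    intro u
    have h : ⟪v, R (J u - lam • (u : lp (fun _ : ℕ => K) 2))⟫_ℂ
        = ⟪v, (u : lp (fun _ : ℕ => K) 2)⟫_ℂ := by rw [hR.1 u]
    rw [← ContinuousLinearMap.adjoint_inner_left, inner_sub_right, inner_smul_right] at h
    rw [inner_add_left, inner_smul_left, Complex.conj_conj, ← h]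
    ring
  have hmem : ContinuousLinearMap.adjoint R v ∈ (LinearPMap.adjoint J).domain :=
    LinearPMap.mem_adjoint_domain_of_exists _ ⟨_, hform⟩
  have happly := LinearPMap.adjoint_apply_eq hsa.dense_domain ⟨_, hmem⟩ hform
  have hgraph : (ContinuousLinearMap.adjoint R v,
      v + (starRingEnd ℂ lam) • ContinuousLinearMap.adjoint R v) ∈ (LinearPMap.adjoint J).graph := by
    rw [← happly]
    exact LinearPMap.mem_graph (LinearPMap.adjoint J) ⟨_, hmem⟩
  rw [hJ, LinearPMap.mem_graph_iff] at hgraph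
  obtain ⟨y, hy1, hy2⟩ := hgraph
  have hy1' : (y : lp (fun _ : ℕ => K) 2) = ContinuousLinearMap.adjoint R v := hy1
  have hy : y = ⟨ContinuousLinearMap.adjoint R v, hy1' ▸ y.2⟩ := Subtype.ext hy1'
  refine ⟨hy1' ▸ y.2, ?_⟩
  rw [← hy, hy2, add_sub_cancel_right]

/-- Solutions of `(J - λ) u = x ⊗ e_k` decay exponentially to the right of `k`, uniformly in `k`. -/
lemma IsBlockJacobi.exists_decay_right {A B : ℕ → K →L[ℂ] K}
    {J : lp (fun _ : ℕ => K) 2 →ₗ.[ℂ] lp (fun _ : ℕ => K) 2} (hJ : IsBlockJacobi J A B)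
    {b : ℝ} (hess : EssSpecFrom J b) {δ : ℝ} (hδ : 0 < δ) {ε : ℝ} (hε : ε ∈ Set.Ioo (0 : ℝ) 1)
    {lam : ℂ} (hlam : lam.re < b) {M : ℝ} (hM : 0 ≤ M) :
    ∃ C : ℝ, 0 ≤ C ∧ ∀ (j k : ℕ) (x : K) (u : J.domain), k ≤ j →
      J u - lam • (u : lp (fun _ : ℕ => K) 2) = lp.single 2 k x →
      ‖(u : lp (fun _ : ℕ => K) 2)‖ ≤ M * ‖x‖ →
      ‖(u : lp (fun _ : ℕ => K) 2) j‖ ≤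
        C * Real.exp (-(gammaFun δ ε b lam.re) * ∑ m ∈ Finset.Ico k j, phiFun δ ‖A m‖) * ‖x‖ := by
  obtain ⟨K₀, hK₀, -, hb⟩ := hess
  have hgap : 0 < b - lam.re := sub_pos.2 hlam
  set c : ℝ := ε * (b - lam.re) with hc
  have hcpos : 0 < c := mul_pos hε.1 hgap
  obtain ⟨N, hN⟩ := hK₀.exists_neg_re_inner_le (half_pos hcpos)
  have ht : 0 ≤ (b - lam.re) * (1 - ε) / δ :=
    div_nonneg (mul_nonneg hgap.le (by linarith [hε.2])) hδ.le
  obtain ⟨hpsi0, hpsi⟩ := psiInv_spec ht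
  set γ : ℝ := gammaFun δ ε b lam.re with hγ
  have hγφ : ∀ i, 0 ≤ γ * phiFun δ ‖A i‖ := fun i =>
    mul_nonneg (mul_nonneg (Real.sqrt_nonneg _) hpsi0) (phiFun_nonneg _ _)
  set D : ℝ := Real.exp (∑ i ∈ Finset.range N, γ * phiFun δ ‖A i‖) with hD
  set C : ℝ := (2 / c) * (1 + ‖K₀‖ * (N * (D * M))) with hC
  refine ⟨C, by positivity, ?_⟩
  intro j k x u hkj hu hnorm
  set d : ℕ → ℝ := fun i => if k ≤ i ∧ i < j then γ * phiFun δ ‖A i‖ else 0 with hd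
  have hd0 : ∀ n, 0 ≤ d n := fun n => by
    simp only [hd]; split_ifs
    exacts [hγφ n, le_rfl]
  have hκ : ∀ n, ‖A n‖ * (d n ^ 2 * Real.exp (d n)) ≤ (b - lam.re) * (1 - ε) := by
    intro n
    have hδψ : δ * psiFun (psiInv ((b - lam.re) * (1 - ε) / δ)) = (b - lam.re) * (1 - ε) := by
      rw [hpsi]; field_simp
    simp only [hd]
    split_ifs
    · rw [← hδψ]
      exact mul_sq_exp_phiFun_le hδ hpsi0
    · have : 0 ≤ (b - lam.re) * (1 - ε) := mul_nonneg hgap.le (by linarith [hε.2])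
      simpa using this
  set f : ℕ → ℝ := fun n => ∑ i ∈ Finset.range n, d i with hf
  have hfilter : ∀ n, f n = ∑ i ∈ (Finset.range n).filter (fun i => k ≤ i ∧ i < j),
      γ * phiFun δ ‖A i‖ := fun n => (Finset.sum_filter _ _).symm
  have hf0 : ∀ n, 0 ≤ f n := fun n => Finset.sum_nonneg fun i _ => hd0 i
  have hfle : ∀ n, f n ≤ ∑ i ∈ Finset.range n, γ * phiFun δ ‖A i‖ := fun n => by
    rw [hfilter]
    exact Finset.sum_le_sum_of_subset_of_nonneg (Finset.filter_subset _ _) fun i _ _ => hγφ i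
  have hfmono : Monotone f := by
    refine monotone_nat_of_le_succ fun n => ?_
    simp only [hf, Finset.sum_range_succ]
    linarith [hd0 n]
  have hfk : f k = 0 := by
    rw [hfilter, Finset.filter_false_of_mem, Finset.sum_empty]
    intro i hi
    have := Finset.mem_range.1 hi
    omega
  have hfj : f j = γ * ∑ m ∈ Finset.Ico k j, phiFun δ ‖A m‖ := by
    rw [hfilter, Finset.mul_sum]
    congr 1
    ext i
    simp only [Finset.mem_filter, Finset.mem_range, Finset.mem_Ico]
    omega
  have hfbound : ∀ n, f n ≤ f j := by
    intro n
    rw [hfilter, hfilter]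
    refine Finset.sum_le_sum_of_subset_of_nonneg (fun i hi => ?_) fun i _ _ => hγφ i
    simp only [Finset.mem_filter, Finset.mem_range] at hi ⊢
    omega
  have hE : ∀ n, Real.exp (f (n + 1)) = Real.exp (d n) * Real.exp (f n) := fun n => by
    rw [← Real.exp_add]
    simp only [hf, Finset.sum_range_succ]
    rw [add_comm]
  set W : lp (fun _ : ℕ => K) 2 →L[ℂ] lp (fun _ : ℕ => K) 2 :=
    weightOp (fun n => Real.exp (f n)) (Real.exp_nonneg (f j)) (fun n => by
      rw [abs_of_pos (Real.exp_pos _)]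
      exact Real.exp_le_exp.2 (hfbound n)) with hWdef
  have hW : ∀ (w : lp (fun _ : ℕ => K) 2) (n : ℕ), W w n = (Real.exp (f n) : ℂ) • w n :=
    fun w n => weightOp_apply _ _ _ w n
  have henergy := hJ.weighted_energy_ge hb hd0 hκ hE hW u
  set w : lp (fun _ : ℕ => K) 2 := (u : lp (fun _ : ℕ => K) 2) with hw
  set v := W w with hv
  have hJu : J u = lp.single 2 k x + lam • w := by rw [← hu]; abel
  have hWsingle : W (lp.single 2 k x) = lp.single 2 k x := by
    ext n
    rw [hW]
    by_cases h : n = k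
    · subst h; simp [hfk]
    · simp [h]
  have hvnorm : ∀ n, ‖v n‖ = Real.exp (f n) * ‖w n‖ := fun n => by
    rw [hv, hW, norm_smul, Complex.norm_real, Real.norm_of_nonneg (Real.exp_nonneg _)]
  have hinner : (⟪W (J u), v⟫_ℂ).re ≤ ‖x‖ * ‖v‖ + lam.re * ‖v‖ ^ 2 := by
    rw [hJu, map_add, map_smul, hWsingle, inner_add_left, inner_smul_left, ← hv,
      inner_self_eq_norm_sq_to_K, Complex.add_re]
    have h1 : (⟪lp.single (E := fun _ : ℕ => K) 2 k x, v⟫_ℂ).re ≤ ‖x‖ * ‖v‖ := by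
      refine (Complex.re_le_norm _).trans ((norm_inner_le_norm _ _).trans ?_)
      rw [lp.norm_single (by norm_num)]
    have h2 : ((starRingEnd ℂ) lam * (‖v‖ : ℂ) ^ 2).re = lam.re * ‖v‖ ^ 2 := by
      rw [← Complex.ofReal_pow, Complex.re_mul_ofReal, Complex.conj_re]
    exact add_le_add h1 h2.le
  have hsum : ∑ m ∈ Finset.range N, ‖v m‖ ≤ N * (D * M) * ‖x‖ := by
    have hle : ∀ m ∈ Finset.range N, ‖v m‖ ≤ D * (M * ‖x‖) := by
      intro m hm
      rw [hvnorm]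
      have h1 : Real.exp (f m) ≤ D :=
        Real.exp_le_exp.2 ((hfmono (Finset.mem_range.1 hm).le).trans (hfle N))
      have h2 : ‖w m‖ ≤ M * ‖x‖ := (lp.norm_apply_le_norm (by norm_num) w m).trans hnorm
      gcongr
    refine (Finset.sum_le_card_nsmul _ _ _ hle).trans (le_of_eq ?_)
    rw [Finset.card_range, nsmul_eq_mul]
    ring
  have hcompact := hN v
  have hquad : c / 2 * ‖v‖ ^ 2 ≤ (‖x‖ + ‖K₀‖ * (N * (D * M) * ‖x‖)) * ‖v‖ := by
    have h1 : ‖K₀‖ * ‖v‖ * ∑ m ∈ Finset.range N, ‖v m‖ ≤ ‖K₀‖ * ‖v‖ * (N * (D * M) * ‖x‖) := by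
      gcongr
    have h2 : (b - (b - lam.re) * (1 - ε)) * ‖v‖ ^ 2 = c * ‖v‖ ^ 2 + lam.re * ‖v‖ ^ 2 := by
      rw [hc]; ring
    linarith
  have hvle : ‖v‖ ≤ C * ‖x‖ := by
    have hrhs : 0 ≤ C * ‖x‖ := by positivity
    by_cases hv0 : ‖v‖ = 0
    · rw [hv0]; exact hrhs
    · have hvpos : 0 < ‖v‖ := lt_of_le_of_ne (norm_nonneg _) (Ne.symm hv0)
      have h1 : c / 2 * ‖v‖ ≤ ‖x‖ + ‖K₀‖ * (N * (D * M) * ‖x‖) := by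
        refine le_of_mul_le_mul_right ?_ hvpos
        linarith
      have h2 : C * ‖x‖ = (‖x‖ + ‖K₀‖ * (N * (D * M) * ‖x‖)) / (c / 2) := by
        rw [hC]; field_simp
      rw [h2, le_div_iff₀ (half_pos hcpos)]
      linarith
  have hfinal : Real.exp (f j) * ‖w j‖ ≤ C * ‖x‖ := by
    rw [← hvnorm]
    exact (lp.norm_apply_le_norm (by norm_num) v j).trans hvle
  have hexp : Real.exp (-γ * ∑ m ∈ Finset.Ico k j, phiFun δ ‖A m‖) = (Real.exp (f j))⁻¹ := by
    rw [← Real.exp_neg, hfj, neg_mul]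
  rw [hexp, mul_right_comm, ← div_eq_mul_inv, le_div_iff₀ (Real.exp_pos _)]
  linarith

/-- **Theorem 3.1.** Decay of the Green matrix of a semi-bounded self-adjoint block Jacobi
operator in an unbounded gap of the essential spectrum. -/
theorem green_matrix_decay_unbounded_gap
    (A B : ℕ → K →L[ℂ] K) (hB : ∀ n, IsSelfAdjoint (B n))
    (J : lp (fun _ : ℕ => K) 2 →ₗ.[ℂ] lp (fun _ : ℕ => K) 2)
    (hJ : IsBlockJacobi J A B) (hsa : IsSelfAdjoint J)
    (hbelow : IsBoundedBelowOp J)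
    (b : ℝ) (hess : EssSpecFrom J b)
    (δ : ℝ) (hδ : 0 < δ) (ε : ℝ) (hε : ε ∈ Set.Ioo (0 : ℝ) 1)
    (lam : ℂ) (hlam : lam.re < b)
    (R : lp (fun _ : ℕ => K) 2 →L[ℂ] lp (fun _ : ℕ => K) 2)
    (hR : IsResolventAt J lam R) :
    ∃ C : ℝ, ∀ j k : ℕ, ∀ x : K,
      ‖(R (lp.single 2 k x)) j‖ ≤
        C * Real.exp (-(gammaFun δ ε b lam.re) *
            ∑ m ∈ Finset.Ico (min j k) (max j k), phiFun δ ‖A m‖) * ‖x‖ := by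
  obtain ⟨C₁, hC₁, h₁⟩ := hJ.exists_decay_right hess hδ hε hlam (norm_nonneg R)
  have hlam' : (starRingEnd ℂ lam).re < b := by rwa [Complex.conj_re]
  obtain ⟨C₂, hC₂, h₂⟩ := hJ.exists_decay_right hess hδ hε hlam'
    (norm_nonneg (ContinuousLinearMap.adjoint R))
  rw [Complex.conj_re] at h₂
  have hbound : ∀ (T : lp (fun _ : ℕ => K) 2 →L[ℂ] lp (fun _ : ℕ => K) 2) (k : ℕ) (x : K),
      ‖T (lp.single 2 k x)‖ ≤ ‖T‖ * ‖x‖ := fun T k x => by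
    simpa only [lp.norm_single (E := fun _ : ℕ => K) (p := 2) (by norm_num) k x] using
      T.le_opNorm (lp.single 2 k x)
  refine ⟨max C₁ C₂, fun j k x => ?_⟩
  rcases le_total k j with hkj | hjk
  · rw [min_eq_right hkj, max_eq_left hkj]
    obtain ⟨hmem, heq⟩ := hR.2 (lp.single 2 k x)
    refine (h₁ j k x ⟨_, hmem⟩ hkj heq (hbound R k x)).trans ?_
    gcongr
    exact le_max_left _ _
  · rw [min_eq_left hjk, max_eq_right hjk]
    set e := Real.exp (-(gammaFun δ ε b lam.re) * ∑ m ∈ Finset.Ico j k, phiFun δ ‖A m‖) with he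
    set y : K := (R (lp.single 2 k x)) j with hy
    obtain ⟨hmem, heq⟩ := hR.adjoint_mem_domain hsa (lp.single 2 j y)
    have hdecay := h₂ k j y ⟨_, hmem⟩ hjk heq (hbound _ j y)
    have hinner : ⟪y, y⟫_ℂ = ⟪ContinuousLinearMap.adjoint R (lp.single 2 j y) k, x⟫_ℂ := by
      have h := ContinuousLinearMap.adjoint_inner_left R (lp.single 2 k x) (lp.single 2 j y)
      have hleft := lp.inner_single_left (𝕜 := ℂ) (G := fun _ : ℕ => K) j y (R (lp.single 2 k x))
      have hright := lp.inner_single_right (𝕜 := ℂ) (G := fun _ : ℕ => K) k x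
        (ContinuousLinearMap.adjoint R (lp.single 2 j y))
      exact hleft.symm.trans (h.symm.trans hright)
    have hsq : ‖y‖ * ‖y‖ ≤ C₂ * e * ‖x‖ * ‖y‖ := by
      rw [← inner_self_eq_norm_mul_norm (𝕜 := ℂ), hinner]
      refine (re_inner_le_norm _ _).trans ?_
      calc _ ≤ C₂ * e * ‖y‖ * ‖x‖ := by gcongr
        _ = _ := by ring
    have hle : ‖y‖ ≤ C₂ * e * ‖x‖ := by
      by_cases hy0 : ‖y‖ = 0
      · rw [hy0]; positivity
      · exact le_of_mul_le_mul_right hsq (lt_of_le_of_ne (norm_nonneg _) (Ne.symm hy0))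
    refine hle.trans ?_
    gcongr
    exact le_max_right _ _
end
end

section
/- Lemma 3.2. Let the block Jacobi operator J be self-adjoint, assume ker A_m = {0} for every m ∈ ℕ, and let L be a compact operator on K with trivial kernel and ‖L‖_{B(K)} = 1. If λ belongs to the discrete spectrum of J (i.e. λ is an eigenvalue of J of finite multiplicity and is an isolated point of σ(J)), then there exists τ₀ > 0 such that for every τ ∈ (0,τ₀) the point λ is not in the spectrum of J(τ) := J + τ·P₁L*LP₁, i.e. J(τ) − λI has an everywhere-defined bounded inverse. -/
noncomputable section

open scoped InnerProductSpace ENNReal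

variable {K : Type*} [NormedAddCommGroup K] [InnerProductSpace ℂ K] [CompleteSpace K]

section SelfAdjointPerturbation

variable {H : Type*} [NormedAddCommGroup H] [InnerProductSpace ℂ H]

/-- `R` is an everywhere-defined bounded inverse of `T − μ`. -/
def LinearPMap.IsBoundedInverseAt (T : H →ₗ.[ℂ] H) (μ : ℂ) (R : H →L[ℂ] H) : Prop :=
  (∀ u : T.domain, R (T u - μ • (u : H)) = u) ∧
  (∀ v : H, ∃ hv : R v ∈ T.domain, T ⟨R v, hv⟩ - μ • (R v) = v)

/-- The resolvent identity. -/
theorem LinearPMap.IsBoundedInverseAt.sub_apply {T : H →ₗ.[ℂ] H} {μ ν : ℂ} {R S : H →L[ℂ] H}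
    (hS : T.IsBoundedInverseAt μ S) (hR : T.IsBoundedInverseAt ν R) (v : H) :
    R v = S v + (ν - μ) • S (R v) := by
  obtain ⟨hv, h⟩ := hR.2 v
  have h2 := hS.1 ⟨R v, hv⟩
  have h3 : T ⟨R v, hv⟩ - μ • R v = v + (ν - μ) • R v := by
    rw [sub_eq_iff_eq_add] at h
    rw [h]; module
  simp only [h3, _root_.map_add, _root_.map_smul] at h2
  exact h2.symm

/-- If `T − (μ + z⁻¹)` is boundedly invertible, then `z` is not in the spectrum of the
resolvent of `T` at `μ`. -/
theorem LinearPMap.IsBoundedInverseAt.notMem_spectrum {T : H →ₗ.[ℂ] H} {μ : ℂ} {z : ℝ}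
    {R S : H →L[ℂ] H} (hS : T.IsBoundedInverseAt μ S) (hz : z ≠ 0)
    (hR : T.IsBoundedInverseAt (μ + (z : ℂ)⁻¹) R) : z ∉ spectrum ℝ S := by
  have hz' : (z : ℂ) ≠ 0 := by exact_mod_cast hz
  rw [spectrum.notMem_iff]
  have hzw : (z : ℂ) * (z : ℂ)⁻¹ = 1 := mul_inv_cancel₀ hz'
  refine ⟨⟨_, (z : ℂ)⁻¹ • (1 + (z : ℂ)⁻¹ • R), ?_, ?_⟩, rfl⟩
  all_goals
    ext v
    have h1 := hS.sub_apply hR v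
    have h2 := hR.sub_apply hS v
    simp only [add_sub_cancel_left, sub_add_cancel_left] at h1 h2
    simp only [Algebra.algebraMap_eq_smul_one, mul_apply_eq_comp,
      _root_.sub_apply, _root_.smul_apply,
      one_apply_eq_self, _root_.add_apply, _root_.map_smul, _root_.map_add,
      _root_.map_sub, ← Complex.coe_smul]
  · linear_combination (norm := module) hzw • (v + (z : ℂ)⁻¹ • R v) + (z : ℂ)⁻¹ • h1
  · linear_combination (norm := module) hzw • (v + (z : ℂ)⁻¹ • R v) - (z : ℂ)⁻¹ • h2

/-- Quantitative lower bound for a positive perturbation `T + τ C`, `C = D* D`, of an operator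
with a spectral gap, when `C` is positive definite on the kernel. -/
theorem LinearPMap.exists_lower_bound {F : Type*} [NormedAddCommGroup F] [InnerProductSpace ℂ F]
    {T : H →ₗ.[ℂ] H} {lam : ℂ}
    (hsym : ∀ u v : T.domain, ⟪T u - lam • (u : H), v⟫_ℂ = ⟪(u : H), T v - lam • (v : H)⟫_ℂ)
    (hfin : FiniteDimensional ℂ (LinearMap.ker (T.toFun - lam • T.domain.subtype)))
    (hgap : ∃ c : ℝ, 0 < c ∧ ∀ u : T.domain,
      (∀ n : T.domain, T n = lam • (n : H) → ⟪(n : H), u⟫_ℂ = 0) →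
      ‖(u : H)‖ ≤ c * ‖T u - lam • (u : H)‖)
    {C : H →L[ℂ] H} {D : H →L[ℂ] F} (hC : ∀ u v, ⟪C u, v⟫_ℂ = ⟪D u, D v⟫_ℂ)
    (hD : ∀ n : T.domain, T n = lam • (n : H) → D n = 0 → (n : H) = 0) :
    ∃ τ₀ : ℝ, 0 < τ₀ ∧ ∀ τ : ℝ, 0 < τ → τ < τ₀ → ∃ c : ℝ, 0 < c ∧ ∀ u : T.domain,
      ‖(u : H)‖ ≤ c * ‖T u - lam • (u : H) + (τ : ℂ) • C u‖ := by
  obtain ⟨c, hc, hgap⟩ := hgap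
  set N : Submodule ℂ H := (LinearMap.ker (T.toFun - lam • T.domain.subtype)).map
    T.domain.subtype with hN
  have hNfin : FiniteDimensional ℂ N := inferInstance
  have hNmem : ∀ n ∈ N, ∃ h : n ∈ T.domain, T ⟨n, h⟩ = lam • n := by
    rintro _ ⟨n, hn, rfl⟩
    exact ⟨n.2, sub_eq_zero.1 (LinearMap.mem_ker.1 hn)⟩
  have hmemN : ∀ n : T.domain, T n = lam • (n : H) → (n : H) ∈ N := fun n hn =>
    ⟨n, LinearMap.mem_ker.2 (sub_eq_zero.2 hn), rfl⟩
  obtain ⟨d, hd, hanti⟩ : ∃ d : ℝ, 0 < d ∧ ∀ n ∈ N, ‖n‖ ≤ d * ‖D n‖ := by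
    obtain ⟨k, hk, h⟩ := LinearMap.exists_antilipschitzWith (D.toLinearMap ∘ₗ N.subtype) (by
      rw [LinearMap.ker_eq_bot']
      rintro ⟨n, hn⟩ h
      obtain ⟨h1, h2⟩ := hNmem n hn
      exact Subtype.ext (hD ⟨n, h1⟩ h2 h))
    refine ⟨k, hk, fun n hn => ?_⟩
    simpa using h.le_mul_dist ⟨n, hn⟩ 0
  set κ : ℝ := ‖C‖ + 1 with hκ
  have hκ0 : 0 < κ := by positivity
  have hCκ : ∀ v, ‖C v‖ ≤ κ * ‖v‖ := fun v =>
    (C.le_opNorm v).trans (by gcongr; simp [hκ])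
  refine ⟨min (1 / (2 * c * κ)) (1 / (4 * c * d ^ 2 * κ ^ 2)), by positivity,
    fun τ hτ hτlt => ?_⟩
  have hτ1 : τ * (2 * c * κ) < 1 :=
    (lt_div_iff₀ (by positivity)).1 (hτlt.trans_le (min_le_left _ _))
  have hτ2 : τ * (4 * c * d ^ 2 * κ ^ 2) < 1 :=
    (lt_div_iff₀ (by positivity)).1 (hτlt.trans_le (min_le_right _ _))
  refine ⟨2 * c + (1 + 2 * c * κ * τ) * (2 * d ^ 2 * (1 / τ + 2 * c * κ)), by positivity,
    fun u => ?_⟩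
  set f : H := T u - lam • (u : H) + (τ : ℂ) • C u with hf
  obtain ⟨n, hn, p, hp, hu⟩ : ∃ n ∈ N, ∃ p ∈ Nᗮ, (u : H) = n + p :=
    ⟨_, N.starProjection_apply_mem u, _, N.sub_starProjection_mem_orthogonal (u : H), by simp⟩
  obtain ⟨hnd, hTn⟩ := hNmem n hn
  have hpd : p ∈ T.domain := by
    rw [show p = u - n by rw [hu]; simp]
    exact T.domain.sub_mem u.2 hnd
  have hu' : u = ⟨n, hnd⟩ + ⟨p, hpd⟩ := Subtype.ext hu
  have hTu : T u - lam • (u : H) = T ⟨p, hpd⟩ - lam • p := by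
    rw [hu', LinearPMap.map_add, hTn]
    simp only [Submodule.coe_add]
    module
  have hpb : ‖p‖ ≤ c * (‖f‖ + τ * (κ * (‖n‖ + ‖p‖))) := by
    refine (hgap ⟨p, hpd⟩ fun m hm => hp _ (hmemN m hm)).trans ?_
    gcongr
    have : T ⟨p, hpd⟩ - lam • p = f - (τ : ℂ) • C u := by rw [hf, hTu]; simp
    simp only [this]
    refine (norm_sub_le _ _).trans ?_
    rw [norm_smul, Complex.norm_real, Real.norm_of_nonneg hτ.le]
    gcongr
    refine (hCκ _).trans ?_
    gcongr
    rw [hu]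
    exact norm_add_le _ _
  have hnb : τ * ‖n‖ ^ 2 ≤ d ^ 2 * (‖f‖ + τ * (κ * ‖p‖)) * ‖n‖ := by
    have h0 : ⟪n, T u - lam • (u : H)⟫_ℂ = 0 := by
      rw [← hsym ⟨n, hnd⟩ u, hTn]; simp
    have h1 : ⟪n, f⟫_ℂ = (τ : ℂ) * (⟪n, C n⟫_ℂ + ⟪n, C p⟫_ℂ) := by
      rw [hf, inner_add_right, h0, zero_add, hu, inner_smul_right, _root_.map_add, inner_add_right]
    have h2 : ⟪n, C n⟫_ℂ = (‖D n‖ : ℂ) ^ 2 := by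
      rw [← inner_conj_symm, hC, inner_conj_symm, inner_self_eq_norm_sq_to_K]; rfl
    have h3 : (τ : ℂ) * (‖D n‖ : ℂ) ^ 2 = ⟪n, f - (τ : ℂ) • C p⟫_ℂ := by
      rw [inner_sub_right, h1, h2, inner_smul_right]; ring
    have h4 : τ * ‖D n‖ ^ 2 ≤ ‖n‖ * (‖f‖ + τ * (κ * ‖p‖)) := by
      have := congrArg norm h3
      rw [norm_mul, norm_pow, Complex.norm_real, Complex.norm_real, norm_norm,
        Real.norm_of_nonneg hτ.le] at this
      rw [this]
      refine (norm_inner_le_norm _ _).trans ?_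
      gcongr
      refine (norm_sub_le _ _).trans ?_
      rw [norm_smul, Complex.norm_real, Real.norm_of_nonneg hτ.le]
      gcongr
      exact hCκ _
    calc τ * ‖n‖ ^ 2 ≤ τ * (d * ‖D n‖) ^ 2 := by gcongr; exact hanti n hn
      _ = d ^ 2 * (τ * ‖D n‖ ^ 2) := by ring
      _ ≤ d ^ 2 * (‖n‖ * (‖f‖ + τ * (κ * ‖p‖))) := by gcongr
      _ = _ := by ring
  have hnb' : τ * ‖n‖ ≤ d ^ 2 * (‖f‖ + τ * (κ * ‖p‖)) := by
    rcases (norm_nonneg n).eq_or_lt with h | h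
    · rw [← h]; simp only [mul_zero]; positivity
    · refine le_of_mul_le_mul_right ?_ h
      linarith
  have hpb' : ‖p‖ ≤ 2 * c * ‖f‖ + 2 * c * κ * τ * ‖n‖ := by
    nlinarith [norm_nonneg p]
  have hnb'' : ‖n‖ ≤ d ^ 2 * (‖f‖ / τ + κ * ‖p‖) := by
    rw [← mul_le_mul_iff_right₀ hτ]
    refine hnb'.trans (le_of_eq ?_)
    field_simp
  have hnn : ‖n‖ ≤ 2 * d ^ 2 * (1 / τ + 2 * c * κ) * ‖f‖ := by
    have h1 : ‖n‖ ≤ d ^ 2 * (‖f‖ / τ + κ * (2 * c * ‖f‖ + 2 * c * κ * τ * ‖n‖)) :=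
      hnb''.trans (by gcongr)
    have h2 : τ * (4 * c * d ^ 2 * κ ^ 2) * ‖n‖ ≤ 1 * ‖n‖ := by gcongr
    have h3 : ‖f‖ / τ = 1 / τ * ‖f‖ := by ring
    rw [h3] at h1
    linarith
  calc ‖(u : H)‖ ≤ ‖n‖ + ‖p‖ := by rw [hu]; exact norm_add_le _ _
    _ ≤ 2 * c * ‖f‖ + (1 + 2 * c * κ * τ) * ‖n‖ := by linarith
    _ ≤ 2 * c * ‖f‖ + (1 + 2 * c * κ * τ) * (2 * d ^ 2 * (1 / τ + 2 * c * κ) * ‖f‖) := by gcongr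
    _ = _ := by ring

variable [CompleteSpace H]

/-- A self-adjoint operator shifted by a point isolated in its spectrum has a self-adjoint
generalized inverse. -/
theorem IsSelfAdjoint.exists_generalized_inverse {S : H →L[ℂ] H} (hS : IsSelfAdjoint S) {z₀ : ℝ}
    (hz : ∀ᶠ z in nhdsWithin z₀ {z₀}ᶜ, z ∉ spectrum ℝ S) :
    ∃ G : H →L[ℂ] H, IsSelfAdjoint G ∧
      G * (S - algebraMap ℝ _ z₀) = (S - algebraMap ℝ _ z₀) * G ∧
      (S - algebraMap ℝ _ z₀) * G * (S - algebraMap ℝ _ z₀) = S - algebraMap ℝ _ z₀ := by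
  have hg : ContinuousOn (fun x : ℝ => (x - z₀)⁻¹) (spectrum ℝ S) := by
    intro x hx
    by_cases h : x = z₀
    · subst h
      have : nhdsWithin x (spectrum ℝ S) ≤ pure x := by
        rw [← nhdsWithin_singleton]
        refine nhdsWithin_le_iff.2 ?_
        rw [eventually_nhdsWithin_iff] at hz
        filter_upwards [nhdsWithin_le_nhds hz, self_mem_nhdsWithin] with y hy hy'
        by_contra hne
        exact hy hne hy'
      exact (tendsto_pure_nhds _ x).mono_left this
    · exact ((continuousAt_id.sub continuousAt_const).inv₀
        (sub_ne_zero.2 h)).continuousWithinAt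
  have hid : cfc (fun x : ℝ => x - z₀) S = S - algebraMap ℝ _ z₀ := by
    rw [cfc_sub (fun x => x) (fun _ => z₀) S, cfc_id' ℝ S, cfc_const z₀ S]
  refine ⟨cfc (fun x : ℝ => (x - z₀)⁻¹) S, cfc_predicate _ S, ?_, ?_⟩
  · rw [← hid]
    exact cfc_commute_cfc _ _ S
  · rw [← hid, ← cfc_mul _ _ S, ← cfc_mul _ _ S]
    refine cfc_congr fun x _ => ?_
    exact mul_inv_mul_cancel (x - z₀)

/-- Spectral gap: a self-adjoint operator is bounded below on the orthogonal complement of the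
eigenspace of an isolated point of its spectrum. -/
theorem LinearPMap.exists_spectral_gap {T : H →ₗ.[ℂ] H} {s : ℝ} (hs : s ≠ 0) {lam : ℂ}
    {S : H →L[ℂ] H} (hS : T.IsBoundedInverseAt (lam + s) S) (hSsa : IsSelfAdjoint S)
    (hz : ∀ᶠ z in nhdsWithin (-s⁻¹) {-s⁻¹}ᶜ, z ∉ spectrum ℝ S) :
    ∃ c : ℝ, 0 < c ∧ ∀ u : T.domain,
      (∀ n : T.domain, T n = lam • (n : H) → ⟪(n : H), u⟫_ℂ = 0) →
      ‖(u : H)‖ ≤ c * ‖T u - lam • (u : H)‖ := by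
  obtain ⟨G, hG, hcomm, hGS⟩ := hSsa.exists_generalized_inverse hz
  have hs' : (s : ℂ) ≠ 0 := by exact_mod_cast hs
  set S' : H →L[ℂ] H := S - algebraMap ℝ _ (-s⁻¹) with hS'
  have hS'app : ∀ v, S' v = S v + (s : ℂ)⁻¹ • v := by
    intro v
    simp [hS', Algebra.algebraMap_eq_smul_one, ← Complex.coe_smul]
  have hS'sa : IsSelfAdjoint S' := hSsa.sub (IsSelfAdjoint.algebraMap _ (.all _))
  refine ⟨‖G‖ * (|s|⁻¹ * ‖S‖) + 1, by positivity, fun u hu => ?_⟩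
  have hfix : G (S' u) = u := by
    set q : H := u - G (S' u) with hq
    have hS'q : S' q = 0 := by
      have := congrArg (fun A : H →L[ℂ] H => A u) hGS
      simp only [mul_apply_eq_comp] at this
      rw [hq, _root_.map_sub, this, sub_self]
    have hS'Gq : S' (G q) = 0 := by
      have := congrArg (fun A : H →L[ℂ] H => A q) hcomm
      simp only [mul_apply_eq_comp] at this
      rw [← this, hS'q, _root_.map_zero]
    have hqs : q = S (-(s : ℂ) • q) := by
      have h := hS'app q
      rw [hS'q] at h
      have : S q = -((s : ℂ)⁻¹ • q) := eq_neg_of_add_eq_zero_left h.symm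
      rw [_root_.map_smul, this, smul_neg, neg_smul, neg_neg, smul_smul, mul_inv_cancel₀ hs', one_smul]
    obtain ⟨hv, hTv⟩ := hS.2 (-(s : ℂ) • q)
    have hqd : q ∈ T.domain := hqs ▸ hv
    have hTq : T ⟨q, hqd⟩ = lam • q := by
      have e : (⟨S (-(s : ℂ) • q), hv⟩ : T.domain) = ⟨q, hqd⟩ := Subtype.ext hqs.symm
      rw [e, ← hqs, sub_eq_iff_eq_add] at hTv
      rw [hTv]; module
    have h0 : ⟪q, q⟫_ℂ = 0 := by
      nth_rewrite 2 [hq]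
      have h1 : ∀ a b, ⟪G a, b⟫_ℂ = ⟪a, G b⟫_ℂ := hG.isSymmetric
      have h2 : ∀ a b, ⟪S' a, b⟫_ℂ = ⟪a, S' b⟫_ℂ := hS'sa.isSymmetric
      rw [inner_sub_right, hu ⟨q, hqd⟩ hTq, ← h1, ← h2, hS'Gq, inner_zero_left, sub_zero]
    exact (sub_eq_zero.1 (inner_self_eq_zero.1 h0)).symm
  have hres : S' u = (s : ℂ)⁻¹ • S (T u - lam • (u : H)) := by
    have h := hS.1 u
    have e : T u - (lam + s) • (u : H) = (T u - lam • (u : H)) - (s : ℂ) • (u : H) := by module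
    rw [e, _root_.map_sub, _root_.map_smul] at h
    rw [hS'app, ← sub_add_cancel (S (T u - lam • (u : H))) ((s : ℂ) • S u), h, smul_add,
      smul_smul, inv_mul_cancel₀ hs', one_smul, add_comm]
  calc ‖(u : H)‖ = ‖G (S' u)‖ := by rw [hfix]
    _ ≤ ‖G‖ * ‖S' u‖ := G.le_opNorm _
    _ = ‖G‖ * (|s|⁻¹ * ‖S (T u - lam • (u : H))‖) := by rw [hres, norm_smul]; simp
    _ ≤ ‖G‖ * (|s|⁻¹ * (‖S‖ * ‖T u - lam • (u : H)‖)) := by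
        gcongr; exact S.le_opNorm _
    _ ≤ _ := by nlinarith [norm_nonneg (T u - lam • (u : H))]

/-- A bounded symmetric perturbation of a self-adjoint operator which is bounded below is
boundedly invertible. -/
theorem LinearPMap.exists_bounded_inverse_of_lower_bound {T : H →ₗ.[ℂ] H} {s : ℝ} {lam : ℂ}
    {S : H →L[ℂ] H} (hS : T.IsBoundedInverseAt (lam + s) S) (hSsa : IsSelfAdjoint S)
    {C : H →L[ℂ] H} (hC : IsSelfAdjoint C)
    (hlb : ∃ c : ℝ, 0 < c ∧ ∀ u : T.domain, ‖(u : H)‖ ≤ c * ‖T u - lam • (u : H) + C u‖) :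
    ∃ R : H →L[ℂ] H, (∀ u : T.domain, R (T u + C u - lam • (u : H)) = u) ∧
      ∀ v : H, ∃ hv : R v ∈ T.domain, T ⟨R v, hv⟩ + C (R v) - lam • R v = v := by
  obtain ⟨c, hc, hlb⟩ := hlb
  set M : H →L[ℂ] H := 1 + (s : ℂ) • S + C * S with hM
  have hMapp : ∀ w, M w = w + (s : ℂ) • S w + C (S w) := fun w => by simp [hM]
  have hMT : ∀ w, ∃ h : S w ∈ T.domain, M w = T ⟨S w, h⟩ - lam • S w + C (S w) := by
    intro w
    obtain ⟨h, hw⟩ := hS.2 w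
    refine ⟨h, ?_⟩
    rw [hMapp]
    nth_rewrite 1 [← hw]
    module
  have hadj : ∀ w x, ⟪M w, x⟫_ℂ = ⟪w, x + (s : ℂ) • S x + S (C x)⟫_ℂ := by
    intro w x
    have h1 : ∀ a b, ⟪S a, b⟫_ℂ = ⟪a, S b⟫_ℂ := hSsa.isSymmetric
    have h2 : ∀ a b, ⟪C a, b⟫_ℂ = ⟪a, C b⟫_ℂ := hC.isSymmetric
    rw [hMapp, inner_add_left, inner_add_left, inner_add_right, inner_add_right, h2, h1,
      inner_smul_left, inner_smul_right, h1, Complex.conj_ofReal]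
  have hbij : Function.Bijective M := by
    rw [ContinuousLinearMap.bijective_iff_dense_range_and_antilipschitz]
    constructor
    · rw [Submodule.topologicalClosure_eq_top_iff, Submodule.eq_bot_iff]
      intro x hx
      have hx0 : x + (s : ℂ) • S x + S (C x) = 0 := by
        refine ext_inner_left ℂ fun w => ?_
        rw [← hadj, inner_zero_right]
        exact hx _ ⟨w, rfl⟩
      have hxS : x = S (-((s : ℂ) • x + C x)) := by
        rw [_root_.map_neg, _root_.map_add, _root_.map_smul]
        rw [add_assoc] at hx0
        exact eq_neg_of_add_eq_zero_left hx0
      obtain ⟨hv, h⟩ := hS.2 (-((s : ℂ) • x + C x))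
      have hxd : x ∈ T.domain := hxS ▸ hv
      have e : (⟨S (-((s : ℂ) • x + C x)), hv⟩ : T.domain) = ⟨x, hxd⟩ := Subtype.ext hxS.symm
      rw [e, ← hxS, sub_eq_iff_eq_add] at h
      have h0 := hlb ⟨x, hxd⟩
      have : T ⟨x, hxd⟩ - lam • x + C x = 0 := by rw [h]; module
      simp only [this, norm_zero, mul_zero] at h0
      simpa using h0
    · set k : ℝ := 1 + (|s| + ‖C‖) * c with hk
      refine ⟨⟨k, by positivity⟩, AddMonoidHomClass.antilipschitz_of_bound M fun w => ?_⟩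
      obtain ⟨h, hw⟩ := hMT w
      have h1 : ‖S w‖ ≤ c * ‖M w‖ := hw ▸ hlb ⟨S w, h⟩
      have h2 : w = M w - ((s : ℂ) • S w + C (S w)) := by rw [hMapp]; module
      have h3 : ‖w‖ ≤ ‖M w‖ + (|s| * ‖S w‖ + ‖C‖ * ‖S w‖) := by
        nth_rewrite 1 [h2]
        refine (norm_sub_le _ _).trans ?_
        gcongr
        refine (norm_add_le _ _).trans ?_
        gcongr
        · rw [norm_smul]; simp
        · exact C.le_opNorm _
      have h4 : (|s| + ‖C‖) * ‖S w‖ ≤ (|s| + ‖C‖) * (c * ‖M w‖) := by gcongr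
      change ‖w‖ ≤ k * ‖M w‖
      rw [hk]
      linarith
  let e := ContinuousLinearEquiv.ofBijective M (LinearMap.ker_eq_bot.2 hbij.1)
    (LinearMap.range_eq_top.2 hbij.2)
  have heM : ∀ w, e w = M w := fun w => rfl
  refine ⟨S ∘L (e.symm : H →L[ℂ] H), fun u => ?_, fun v => ?_⟩
  · have hu := hS.1 u
    obtain ⟨h, hw⟩ := hMT (T u - (lam + s) • (u : H))
    have hT : (⟨S (T u - (lam + s) • (u : H)), h⟩ : T.domain) = u := Subtype.ext hu
    rw [hT, hu] at hw
    have : T u + C u - lam • (u : H) = e (T u - (lam + s) • (u : H)) := by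
      rw [heM, hw]; module
    rw [this]
    simpa using hu
  · obtain ⟨h, hw⟩ := hMT (e.symm v)
    refine ⟨h, ?_⟩
    rw [← heM, ContinuousLinearEquiv.apply_symm_apply] at hw
    nth_rewrite 4 [hw]
    simp only [ContinuousLinearMap.comp_apply, ContinuousLinearEquiv.coe_coe]
    module

/-- Let `lam` be a discrete eigenvalue of a self-adjoint operator `T` and let `C = D* D` be bounded
and positive definite on the eigenspace. Then `T + τ C − lam` is boundedly invertible for all
sufficiently small `τ > 0`. -/
theorem LinearPMap.exists_bounded_inverse_add_smul {F : Type*} [NormedAddCommGroup F]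
    [InnerProductSpace ℂ F] {T : H →ₗ.[ℂ] H} (hT : IsSelfAdjoint T) {lam : ℂ}
    (heig : ∃ u : T.domain, (u : H) ≠ 0 ∧ T u = lam • (u : H))
    (hfin : FiniteDimensional ℂ (LinearMap.ker (T.toFun - lam • T.domain.subtype)))
    (hisol : ∃ r : ℝ, 0 < r ∧ ∀ μ : ℂ, μ ≠ lam → ‖μ - lam‖ < r →
      ∃ R : H →L[ℂ] H, T.IsBoundedInverseAt μ R)
    {C : H →L[ℂ] H} {D : H →L[ℂ] F} (hC : ∀ u v, ⟪C u, v⟫_ℂ = ⟪D u, D v⟫_ℂ)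
    (hD : ∀ n : T.domain, T n = lam • (n : H) → D n = 0 → (n : H) = 0) :
    ∃ τ₀ : ℝ, 0 < τ₀ ∧ ∀ τ : ℝ, 0 < τ → τ < τ₀ → ∃ R : H →L[ℂ] H,
      (∀ u : T.domain, R (T u + (τ : ℂ) • C u - lam • (u : H)) = u) ∧
      ∀ v : H, ∃ hv : R v ∈ T.domain, T ⟨R v, hv⟩ + (τ : ℂ) • C (R v) - lam • R v = v := by
  have hsym : ∀ u v : T.domain, ⟪T u, (v : H)⟫_ℂ =
      ⟪(u : H), T v⟫_ℂ := by
    have h := LinearPMap.adjoint_isFormalAdjoint hT.dense_domain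
    rwa [LinearPMap.isSelfAdjoint_def.1 hT] at h
  have hlam : (starRingEnd ℂ) lam = lam := by
    obtain ⟨u, hu0, hu⟩ := heig
    have h := hsym u u
    rw [hu, inner_smul_left, inner_smul_right] at h
    exact mul_right_cancel₀ (inner_self_ne_zero.2 hu0) h
  obtain ⟨r, hr, hres⟩ := hisol
  obtain ⟨s, hs, hsr⟩ := exists_between hr
  have hs0 : s ≠ 0 := hs.ne'
  obtain ⟨S, hS⟩ : ∃ S, T.IsBoundedInverseAt (lam + s) S := by
    refine hres (lam + s) (by simpa using hs0) ?_
    rw [add_sub_cancel_left, Complex.norm_real, Real.norm_of_nonneg hs.le]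
    exact hsr
  have hSsa : IsSelfAdjoint S := by
    rw [ContinuousLinearMap.isSelfAdjoint_iff_isSymmetric]
    intro v w
    obtain ⟨hv, hv'⟩ := hS.2 v
    obtain ⟨hw, hw'⟩ := hS.2 w
    have h := hsym ⟨S v, hv⟩ ⟨S w, hw⟩
    rw [sub_eq_iff_eq_add] at hv' hw'
    rw [hv', hw', inner_add_left, inner_add_right, inner_smul_left, inner_smul_right, _root_.map_add,
      hlam, Complex.conj_ofReal] at h
    exact (add_right_cancel h).symm
  have hspec : ∀ᶠ z in nhdsWithin (-s⁻¹) {-s⁻¹}ᶜ, z ∉ spectrum ℝ S := by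
    have hne : -s⁻¹ ≠ 0 := neg_ne_zero.2 (inv_ne_zero hs0)
    have hcont : ContinuousAt (fun z : ℝ => |s + z⁻¹|) (-s⁻¹) :=
      (continuousAt_const.add (continuousAt_inv₀ hne)).abs
    have hnear := hcont.eventually_lt_const (show |s + (-s⁻¹)⁻¹| < r by simpa using hr)
    filter_upwards [nhdsWithin_le_nhds hnear, nhdsWithin_le_nhds (eventually_ne_nhds hne),
      self_mem_nhdsWithin] with z hz hz0 hzs
    have hsub : lam + (s : ℂ) + (z : ℂ)⁻¹ - lam = ((s + z⁻¹ : ℝ) : ℂ) := by push_cast; ring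
    have hmem : lam + s + (z : ℂ)⁻¹ ≠ lam := fun h => by
      have h1 : s + z⁻¹ = 0 := by
        rw [h, sub_self] at hsub
        exact_mod_cast hsub.symm
      exact hzs (by
        rw [Set.mem_singleton_iff, eq_neg_of_add_eq_zero_left h1, inv_neg, inv_inv, neg_neg])
    obtain ⟨R, hR⟩ := hres _ hmem (by rw [hsub, Complex.norm_real]; exact hz)
    exact hS.notMem_spectrum hz0 hR
  have hCsa : IsSelfAdjoint C := by
    rw [ContinuousLinearMap.isSelfAdjoint_iff_isSymmetric]
    intro u v
    change ⟪C u, v⟫_ℂ = ⟪u, C v⟫_ℂ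
    rw [hC, ← inner_conj_symm u, hC, inner_conj_symm]
  obtain ⟨τ₀, hτ₀, hbound⟩ := T.exists_lower_bound (lam := lam)
    (fun u v => by
      rw [inner_sub_left, inner_sub_right, hsym, inner_smul_left, inner_smul_right, hlam])
    hfin (LinearPMap.exists_spectral_gap hs0 hS hSsa hspec) hC hD
  refine ⟨τ₀, hτ₀, fun τ h1 h2 => ?_⟩
  have hτC : IsSelfAdjoint ((τ : ℂ) • C) := by
    have hτ : IsSelfAdjoint (τ : ℂ) := Complex.conj_ofReal τ
    exact hτ.smul hCsa
  have h := LinearPMap.exists_bounded_inverse_of_lower_bound hS hSsa hτC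
  simp only [_root_.smul_apply] at h
  exact h (hbound τ h1 h2)

end SelfAdjointPerturbation

/-- A block Jacobi operator acts on its whole domain by the block Jacobi difference expression. -/
theorem IsBlockJacobi.apply_eq {J : lp (fun _ : ℕ => K) 2 →ₗ.[ℂ] lp (fun _ : ℕ => K) 2}
    {A B : ℕ → K →L[ℂ] K} (hJ : IsBlockJacobi J A B) (u : J.domain) (n : ℕ) :
    (J u) n = jacApply A B (fun m => (u : lp (fun _ : ℕ => K) 2) m) n := by
  have hcoord : ∀ m : ℕ, Continuous fun v : lp (fun _ : ℕ => K) 2 => (v m : K) := fun m =>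
    (lp.evalCLM ℂ (fun _ : ℕ => K) 2 m).continuous
  have hclosed : IsClosed {p : lp (fun _ : ℕ => K) 2 × lp (fun _ : ℕ => K) 2 |
      (p.2 n : K) = jacApply A B (fun m => p.1 m) n} := by
    refine isClosed_eq ((hcoord n).comp continuous_snd) ?_
    have h1 : ∀ (T : K →L[ℂ] K) (m : ℕ), Continuous
        fun p : lp (fun _ : ℕ => K) 2 × lp (fun _ : ℕ => K) 2 => T (p.1 m) := fun T m =>
      T.continuous.comp ((hcoord m).comp continuous_fst)
    cases n with
    | zero => exact (h1 _ _).add (h1 _ _)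
    | succ k => exact ((h1 _ _).add (h1 _ _)).add (h1 _ _)
  refine closure_minimal ?_ hclosed (hJ.isClosure u)
  rintro ⟨v, w⟩ ⟨hv, hfs, hw⟩
  have h := hJ.apply_fin v hv hfs n
  rw [hw] at h
  exact h

/-- If all off-diagonal entries are injective, an eigenvector of a block Jacobi operator is
determined by its first coordinate. -/
theorem IsBlockJacobi.eq_zero_of_apply_zero
    {J : lp (fun _ : ℕ => K) 2 →ₗ.[ℂ] lp (fun _ : ℕ => K) 2}
    {A B : ℕ → K →L[ℂ] K} (hJ : IsBlockJacobi J A B)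
    (hkerA : ∀ m, ∀ x : K, A m x = 0 → x = 0) {lam : ℂ} {u : J.domain}
    (hu : J u = lam • (u : lp (fun _ : ℕ => K) 2)) (h0 : (u : lp (fun _ : ℕ => K) 2) 0 = 0) :
    (u : lp (fun _ : ℕ => K) 2) = 0 := by
  have hrec : ∀ n, jacApply A B (fun m => (u : lp (fun _ : ℕ => K) 2) m) n =
      lam • (u : lp (fun _ : ℕ => K) 2) n := fun n => by
    rw [← hJ.apply_eq, hu]; rfl
  have hpair : ∀ n, (u : lp (fun _ : ℕ => K) 2) n = 0 ∧ (u : lp (fun _ : ℕ => K) 2) (n + 1) = 0 := by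
    intro n
    induction n with
    | zero =>
      refine ⟨h0, hkerA 0 _ ?_⟩
      simpa [jacApply, h0] using hrec 0
    | succ k ih =>
      refine ⟨ih.2, hkerA (k + 1) _ ?_⟩
      simpa [jacApply, ih.1, ih.2] using hrec (k + 1)
  exact lp.ext (funext fun n => (hpair n).1)

/-- **Lemma 3.2.** If all `A_m` are injective, `L` is a compact injective operator of norm one
and `λ` belongs to the discrete spectrum of the self-adjoint block Jacobi operator `J`, then for
all sufficiently small `τ > 0` the point `λ` is not in the spectrum of
`J(τ) = J + τ·P₁L*LP₁`. -/
theorem perturbed_jacobi_not_in_spectrum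
    (A B : ℕ → K →L[ℂ] K) (hB : ∀ n, IsSelfAdjoint (B n))
    (hkerA : ∀ m, ∀ x : K, A m x = 0 → x = 0)
    (J : lp (fun _ : ℕ => K) 2 →ₗ.[ℂ] lp (fun _ : ℕ => K) 2)
    (hJ : IsBlockJacobi J A B) (hsa : IsSelfAdjoint J)
    (L : K →L[ℂ] K) (hLcomp : IsCompactOperator L)
    (hLker : ∀ x : K, L x = 0 → x = 0) (hLnorm : ‖L‖ = 1)
    (lam : ℂ)
    -- `λ` is an eigenvalue of `J` ...
    (heig : ∃ u : J.domain, (u : lp (fun _ : ℕ => K) 2) ≠ 0 ∧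
      J u = lam • (u : lp (fun _ : ℕ => K) 2))
    -- ... of finite multiplicity ...
    (hfin : FiniteDimensional ℂ
      ↥(LinearMap.ker (J.toFun - lam • J.domain.subtype)))
    -- ... and an isolated point of `σ(J)`.
    (hisol : ∃ r : ℝ, 0 < r ∧ ∀ μ : ℂ, μ ≠ lam → ‖μ - lam‖ < r →
      ∃ R : lp (fun _ : ℕ => K) 2 →L[ℂ] lp (fun _ : ℕ => K) 2, IsResolventAt J μ R) :
    ∃ τ₀ : ℝ, 0 < τ₀ ∧ ∀ τ : ℝ, 0 < τ → τ < τ₀ →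
      ∃ R : lp (fun _ : ℕ => K) 2 →L[ℂ] lp (fun _ : ℕ => K) 2,
        (∀ u : J.domain,
          R (J u + (τ : ℂ) • lp.single 2 0
              (ContinuousLinearMap.adjoint L (L ((u : lp (fun _ : ℕ => K) 2) 0)))
            - lam • (u : lp (fun _ : ℕ => K) 2)) = u) ∧
        (∀ v : lp (fun _ : ℕ => K) 2, ∃ hv : R v ∈ J.domain,
          J ⟨R v, hv⟩ + (τ : ℂ) • lp.single 2 0
              (ContinuousLinearMap.adjoint L (L ((R v) 0)))
            - lam • (R v) = v) := by
  exact LinearPMap.exists_bounded_inverse_add_smul hsa heig hfin hisol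
    (C := lp.singleContinuousLinearMap ℂ (fun _ : ℕ => K) 2 0 ∘L
      ContinuousLinearMap.adjoint L ∘L L ∘L lp.evalCLM ℂ (fun _ : ℕ => K) 2 0)
    (D := L ∘L lp.evalCLM ℂ (fun _ : ℕ => K) 2 0)
    (fun u v => by
      change ⟪lp.single 2 0 (ContinuousLinearMap.adjoint L (L (u 0))), v⟫_ℂ =
        ⟪L (u 0), L (v 0)⟫_ℂ
      rw [lp.inner_single_left, ContinuousLinearMap.adjoint_inner_left])
    (fun n hn hDn => hJ.eq_zero_of_apply_zero hkerA hn (hLker _ hDn))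
end
end

section
/- Corollary 3.4(a). Assume the block Jacobi operator J is self-adjoint and bounded from below, that ‖A_k‖_{B(K)} → ∞ as k → ∞, and let b ∈ ℝ be such that there exists a compact self-adjoint operator K₀ on H with ⟨(J−K₀)u,u⟩ ≥ b‖u‖² for all u ∈ dom J (i.e. the essential spectrum of J lies in [b,∞)). Fix ε ∈ (0,1). If λ ∉ σ(J) and Re λ < b, then there is a constant C_a, independent of m and j, such that ‖G_{mj}(λ)‖_{B(K)} ≤ C_a·exp(−(1−ε)·√(b−Re λ)·Σ_{k=min(m,j)}^{max(m,j)−1} 1/√(‖A_k‖_{B(K)})) for all m,j ∈ ℕ. -/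
noncomputable section

open scoped InnerProductSpace ENNReal

variable {K : Type*} [NormedAddCommGroup K] [InnerProductSpace ℂ K] [CompleteSpace K]

section WeightedEstimates

/-- The diagonal operator on `ℓ²(ℕ,K)` with entries `w n` for `n < M` and `w M` for `n ≥ M`. -/
def diagCLM (K : Type*) [NormedAddCommGroup K] [InnerProductSpace ℂ K] (w : ℕ → ℝ) (M : ℕ) :
    lp (fun _ : ℕ => K) 2 →L[ℂ] lp (fun _ : ℕ => K) 2 :=
  ((w M : ℝ) : ℂ) • ContinuousLinearMap.id ℂ _ + ∑ n ∈ Finset.range M,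
    ((w n - w M : ℝ) : ℂ) • (lp.singleContinuousLinearMap ℂ (fun _ : ℕ => K) 2 n ∘L
      lp.evalCLM ℂ (fun _ : ℕ => K) 2 n)

theorem diagCLM_apply {E : Type*} [NormedAddCommGroup E] [InnerProductSpace ℂ E]
    {w : ℕ → ℝ} {M : ℕ} (hw : ∀ n, M ≤ n → w n = w M)
    (v : lp (fun _ : ℕ => E) 2) (n : ℕ) : diagCLM E w M v n = (w n : ℂ) • v n := by
  have h : diagCLM E w M v = ((w M : ℝ) : ℂ) • v + ∑ n ∈ Finset.range M,
      ((w n - w M : ℝ) : ℂ) • lp.single 2 n (v n) := by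
    simp [diagCLM, lp.evalCLM]
    rfl
  rw [h]
  simp only [lp.coeFn_add, lp.coeFn_smul, lp.coeFn_sum, Pi.add_apply, Pi.smul_apply,
    Finset.sum_apply, lp.single_apply, Pi.single_apply, smul_ite, smul_zero, Finset.sum_ite_eq,
    Finset.mem_range]
  split_ifs with hn
  · rw [← add_smul]; congr 1; push_cast; ring
  · rw [add_zero, hw n (not_lt.1 hn)]

theorem IsFinSupp.exists_forall_ge {E : Type*} [NormedAddCommGroup E]
    {v : lp (fun _ : ℕ => E) 2} (hv : IsFinSupp v) :
    ∃ M, ∀ n, M ≤ n → v n = 0 := by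
  obtain ⟨M, hM⟩ := hv.bddAbove
  refine ⟨M + 1, fun n hn => ?_⟩
  by_contra h
  have := hM (show n ∈ {n | v n ≠ 0} from h)
  omega

theorem lp_norm_sq_sub_norm_compl_sq {E : Type*} [NormedAddCommGroup E]
    (u : lp (fun _ : ℕ => E) 2) (s : Finset ℕ) :
    ‖u‖ ^ 2 - ‖u - ∑ i ∈ s, lp.single 2 i (u i)‖ ^ 2 = ∑ i ∈ s, ‖u i‖ ^ 2 := by
  have := lp.norm_sub_norm_compl_sub_single (E := fun _ : ℕ => E) (p := 2) (by norm_num) u s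
  simpa using this

theorem lp_sum_norm_sq_le {E : Type*} [NormedAddCommGroup E]
    (u : lp (fun _ : ℕ => E) 2) (s : Finset ℕ) :
    ∑ i ∈ s, ‖u i‖ ^ 2 ≤ ‖u‖ ^ 2 := by
  have := lp_norm_sq_sub_norm_compl_sq u s
  nlinarith [sq_nonneg ‖u - ∑ i ∈ s, lp.single 2 i (u i)‖]

theorem lp_norm_compl_le {E : Type*} [NormedAddCommGroup E]
    (u : lp (fun _ : ℕ => E) 2) (s : Finset ℕ) :
    ‖u - ∑ i ∈ s, lp.single 2 i (u i)‖ ≤ ‖u‖ := by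
  have := lp_norm_sq_sub_norm_compl_sq u s
  have h2 : 0 ≤ ∑ i ∈ s, ‖u i‖ ^ 2 := by positivity
  exact le_of_sq_le_sq (by linarith) (norm_nonneg _)

theorem lp_norm_sum_single_sq {E : Type*} [NormedAddCommGroup E]
    (u : lp (fun _ : ℕ => E) 2) (s : Finset ℕ) :
    ‖∑ i ∈ s, lp.single 2 i (u i)‖ ^ 2 = ∑ i ∈ s, ‖u i‖ ^ 2 := by
  have := lp.norm_sum_single (E := fun _ : ℕ => E) (p := 2) (by norm_num) (fun i => u i) s
  simpa using this

theorem inner_compl_single_comm {E : Type*} [NormedAddCommGroup E] [InnerProductSpace ℂ E]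
    (u z : lp (fun _ : ℕ => E) 2) (s : Finset ℕ) :
    ⟪z, u - ∑ i ∈ s, lp.single 2 i (u i)⟫_ℂ = ⟪z - ∑ i ∈ s, lp.single 2 i (z i), u⟫_ℂ := by
  simp only [inner_sub_left, inner_sub_right, sum_inner, inner_sum, lp.inner_single_left,
    lp.inner_single_right]

/-- The tails of the elements of a compact subset of `ℓ²` are uniformly small. -/
theorem IsCompact.exists_norm_tail_le {E : Type*} [NormedAddCommGroup E]
    {S : Set (lp (fun _ : ℕ => E) 2)} (hS : IsCompact S)
    {η : ℝ} (hη : 0 < η) :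
    ∃ N : ℕ, ∀ n, N ≤ n → ∀ z ∈ S, ‖z - ∑ i ∈ Finset.range n, lp.single 2 i (z i)‖ ≤ η := by
  refine hS.induction_on (p := fun S => ∃ N : ℕ, ∀ n, N ≤ n → ∀ z ∈ S,
    ‖z - ∑ i ∈ Finset.range n, lp.single 2 i (z i)‖ ≤ η) ⟨0, by simp⟩ ?_ ?_ ?_
  · rintro s t hst ⟨N, hN⟩
    exact ⟨N, fun n hn z hz => hN n hn z (hst hz)⟩
  · rintro s t ⟨N, hN⟩ ⟨N', hN'⟩
    refine ⟨max N N', fun n hn z hz => ?_⟩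
    rcases hz with hz | hz
    · exact hN n ((le_max_left _ _).trans hn) z hz
    · exact hN' n ((le_max_right _ _).trans hn) z hz
  · intro y _
    have hy := (lp.hasSum_single (E := fun _ : ℕ => E) (p := 2) (by norm_num) y).tendsto_sum_nat
    obtain ⟨N, hN⟩ := Metric.tendsto_atTop.1 hy (η / 2) (by positivity)
    refine ⟨Metric.ball y (η / 2), mem_nhdsWithin_of_mem_nhds
      (Metric.ball_mem_nhds y (by positivity)), N, fun n hn z hz => ?_⟩
    have h1 := hN n hn
    rw [dist_comm, dist_eq_norm] at h1
    have h2 := lp_norm_compl_le (z - y) (Finset.range n)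
    rw [Metric.mem_ball, dist_eq_norm] at hz
    have h3 : z - ∑ i ∈ Finset.range n, lp.single 2 i (z i) =
        ((z - y) - ∑ i ∈ Finset.range n, lp.single 2 i ((z - y) i)) +
        (y - ∑ i ∈ Finset.range n, lp.single 2 i (y i)) := by
      simp only [lp.coeFn_sub, Pi.sub_apply, lp.single_sub, Finset.sum_sub_distrib]
      abel
    rw [h3]
    refine (norm_add_le _ _).trans ?_
    linarith

/-- The quadratic form of a compact operator on `ℓ²` is small up to finitely many coordinates. -/
theorem IsCompactOperator.exists_neg_le_re_inner {E : Type*} [NormedAddCommGroup E] [InnerProductSpace ℂ E]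
    {T : lp (fun _ : ℕ => E) 2 →L[ℂ] lp (fun _ : ℕ => E) 2} (hT : IsCompactOperator T)
    {η : ℝ} (hη : 0 < η) :
    ∃ (N : ℕ) (C : ℝ), 0 ≤ C ∧ ∀ u : lp (fun _ : ℕ => E) 2,
      -(η * ‖u‖ ^ 2) - C * ∑ i ∈ Finset.range N, ‖u i‖ ^ 2 ≤ (⟪T u, u⟫_ℂ).re := by
  have hc := IsCompactOperator.isCompact_closure_image_closedBall
    (f := (T : lp (fun _ : ℕ => E) 2 →ₗ[ℂ] lp (fun _ : ℕ => E) 2)) hT 1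
  obtain ⟨N, hN⟩ := hc.exists_norm_tail_le (half_pos hη)
  have hN := hN N le_rfl
  have key (u : lp (fun _ : ℕ => E) 2) :
      ‖T u - ∑ i ∈ Finset.range N, lp.single 2 i (T u i)‖ ≤ η / 2 * ‖u‖ := by
    rcases eq_or_ne u 0 with rfl | hu
    · simp
    have hu' : 0 < ‖u‖ := norm_pos_iff.2 hu
    have h := hN (T (((‖u‖⁻¹ : ℝ) : ℂ) • u)) (subset_closure ⟨_, by simp [norm_smul, hu'.ne'], rfl⟩)
    have e : T (((‖u‖⁻¹ : ℝ) : ℂ) • u) - ∑ i ∈ Finset.range N,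
        lp.single 2 i (T (((‖u‖⁻¹ : ℝ) : ℂ) • u) i) =
        ((‖u‖⁻¹ : ℝ) : ℂ) • (T u - ∑ i ∈ Finset.range N, lp.single 2 i (T u i)) := by
      simp only [map_smul, lp.coeFn_smul, Pi.smul_apply, lp.single_smul, smul_sub,
        Finset.smul_sum]
    rw [e, norm_smul, Complex.norm_real, norm_inv, norm_norm, inv_mul_le_iff₀ hu'] at h
    linarith
  refine ⟨N, ‖T‖ ^ 2 / (2 * η), by positivity, fun u => ?_⟩
  set h := ∑ i ∈ Finset.range N, lp.single (E := fun _ : ℕ => E) 2 i (u i) with hh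
  have hsq := lp_norm_sum_single_sq u (Finset.range N)
  rw [← hh] at hsq
  have e : ⟪T u, u⟫_ℂ = ⟪T u, h⟫_ℂ +
      ⟪T u - ∑ i ∈ Finset.range N, lp.single 2 i (T u i), u⟫_ℂ := by
    rw [← inner_compl_single_comm, ← inner_add_right, add_sub_cancel]
  have h1 : -(‖T‖ * ‖u‖ * ‖h‖) ≤ (⟪T u, h⟫_ℂ).re := by
    have a := (Complex.abs_re_le_norm _).trans (norm_inner_le_norm (𝕜 := ℂ) (T u) h)
    have b := mul_le_mul_of_nonneg_right (T.le_opNorm u) (norm_nonneg h)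
    linarith [neg_abs_le (⟪T u, h⟫_ℂ).re]
  have h2 : -(η / 2 * ‖u‖ * ‖u‖) ≤
      (⟪T u - ∑ i ∈ Finset.range N, lp.single 2 i (T u i), u⟫_ℂ).re := by
    have a := (Complex.abs_re_le_norm _).trans (norm_inner_le_norm (𝕜 := ℂ)
      (T u - ∑ i ∈ Finset.range N, lp.single 2 i (T u i)) u)
    have b := mul_le_mul_of_nonneg_right (key u) (norm_nonneg u)
    linarith [neg_abs_le (⟪T u - ∑ i ∈ Finset.range N, lp.single 2 i (T u i), u⟫_ℂ).re]
  have h3 : ‖T‖ * ‖u‖ * ‖h‖ ≤ η / 2 * ‖u‖ ^ 2 + ‖T‖ ^ 2 / (2 * η) * ‖h‖ ^ 2 := by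
    have : 0 ≤ (η * ‖u‖ - ‖T‖ * ‖h‖) ^ 2 / (2 * η) := by positivity
    have e2 : (η * ‖u‖ - ‖T‖ * ‖h‖) ^ 2 / (2 * η) =
      η / 2 * ‖u‖ ^ 2 + ‖T‖ ^ 2 / (2 * η) * ‖h‖ ^ 2 - ‖T‖ * ‖u‖ * ‖h‖ := by
      field_simp
      ring
    linarith
  rw [e, Complex.add_re, ← hsq]
  nlinarith

/-- Conjugating a block Jacobi expression with a diagonal weight changes its quadratic form only
through the off-diagonal differences of the weight. -/
theorem sum_re_inner_jacApply_weight_sub (A B : ℕ → K →L[ℂ] K) (w : ℕ → ℝ) (v : ℕ → K) (M : ℕ) :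
    ∑ n ∈ Finset.range (M + 1), (⟪(w n : ℂ) • jacApply A B v n -
        jacApply A B (fun i => (w i : ℂ) • v i) n, (w n : ℂ) • v n⟫_ℂ).re =
      ∑ k ∈ Finset.range M, (w (k + 1) - w k) ^ 2 * (⟪A k (v (k + 1)), v k⟫_ℂ).re +
        (w M - w (M + 1)) * w M * (⟪A M (v (M + 1)), v M⟫_ℂ).re := by
  induction M with
  | zero =>
    have e : (w 0 : ℂ) • jacApply A B v 0 - jacApply A B (fun i => (w i : ℂ) • v i) 0 =
        ((w 0 - w 1 : ℝ) : ℂ) • A 0 (v 1) := by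
      simp only [jacApply, map_smul, Complex.ofReal_sub]
      module
    simp only [zero_add, Finset.range_one, Finset.sum_singleton, Finset.range_zero,
      Finset.sum_empty]
    rw [e, inner_smul_left, inner_smul_right, Complex.conj_ofReal, Complex.re_ofReal_mul,
      Complex.re_ofReal_mul, mul_assoc]
  | succ k ih =>
    have e : (w (k + 1) : ℂ) • jacApply A B v (k + 1) -
        jacApply A B (fun i => (w i : ℂ) • v i) (k + 1) =
        ((w (k + 1) - w k : ℝ) : ℂ) • ContinuousLinearMap.adjoint (A k) (v k) +
        ((w (k + 1) - w (k + 2) : ℝ) : ℂ) • A (k + 1) (v (k + 2)) := by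
      simp only [jacApply, map_smul, Complex.ofReal_sub]
      module
    have e2 : (⟪ContinuousLinearMap.adjoint (A k) (v k), v (k + 1)⟫_ℂ).re =
        (⟪A k (v (k + 1)), v k⟫_ℂ).re := by
      rw [ContinuousLinearMap.adjoint_inner_left]
      exact inner_re_symm (𝕜 := ℂ) _ _
    rw [Finset.sum_range_succ, ih, Finset.sum_range_succ, e, inner_add_left, inner_smul_left,
      inner_smul_left, inner_smul_right, inner_smul_right, Complex.conj_ofReal,
      Complex.conj_ofReal, Complex.add_re]
    simp only [Complex.re_ofReal_mul]
    rw [e2]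
    ring

theorem neg_le_sum_re_inner_jacApply_weight_sub (A B : ℕ → K →L[ℂ] K) {w : ℕ → ℝ}
    (hw0 : ∀ n, 0 < w n) {s : ℝ} (hs : 0 ≤ s)
    (hw : ∀ k, (w (k + 1) - w k) ^ 2 * ‖A k‖ ≤ s * (w k * w (k + 1))) (v : ℕ → K) (M : ℕ)
    (hv : v (M + 1) = 0) :
    -(s * ∑ n ∈ Finset.range (M + 1), ‖(w n : ℂ) • v n‖ ^ 2) ≤
      ∑ n ∈ Finset.range (M + 1), (⟪(w n : ℂ) • jacApply A B v n -
        jacApply A B (fun i => (w i : ℂ) • v i) n, (w n : ℂ) • v n⟫_ℂ).re := by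
  rw [sum_re_inner_jacApply_weight_sub, hv, map_zero, inner_zero_left, Complex.zero_re, mul_zero,
    add_zero]
  have hterm (k : ℕ) : -(s / 2 * (‖(w k : ℂ) • v k‖ ^ 2 + ‖(w (k + 1) : ℂ) • v (k + 1)‖ ^ 2)) ≤
      (w (k + 1) - w k) ^ 2 * (⟪A k (v (k + 1)), v k⟫_ℂ).re := by
    have a := (Complex.abs_re_le_norm _).trans (norm_inner_le_norm (𝕜 := ℂ) (A k (v (k + 1))) (v k))
    have b := mul_le_mul_of_nonneg_right ((A k).le_opNorm (v (k + 1))) (norm_nonneg (v k))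
    have c : -(‖A k‖ * ‖v (k + 1)‖ * ‖v k‖) ≤ (⟪A k (v (k + 1)), v k⟫_ℂ).re := by
      linarith [neg_abs_le (⟪A k (v (k + 1)), v k⟫_ℂ).re]
    have d := mul_le_mul_of_nonneg_left c (sq_nonneg (w (k + 1) - w k))
    have f := mul_le_mul_of_nonneg_right (hw k)
      (mul_nonneg (norm_nonneg (v (k + 1))) (norm_nonneg (v k)))
    rw [norm_smul, norm_smul, Complex.norm_of_nonneg (hw0 _).le, Complex.norm_of_nonneg (hw0 _).le]
    have g : 0 ≤ s / 2 * (w k * ‖v k‖ - w (k + 1) * ‖v (k + 1)‖) ^ 2 := by positivity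
    nlinarith
  have h1 : ∑ k ∈ Finset.range M, ‖(w k : ℂ) • v k‖ ^ 2 ≤
      ∑ n ∈ Finset.range (M + 1), ‖(w n : ℂ) • v n‖ ^ 2 := by
    rw [Finset.sum_range_succ]
    exact le_add_of_nonneg_right (by positivity)
  have h2 : ∑ k ∈ Finset.range M, ‖(w (k + 1) : ℂ) • v (k + 1)‖ ^ 2 ≤
      ∑ n ∈ Finset.range (M + 1), ‖(w n : ℂ) • v n‖ ^ 2 := by
    rw [Finset.sum_range_succ']
    exact le_add_of_nonneg_right (by positivity)
  have h3 := Finset.sum_le_sum (s := Finset.range M) fun k _ => hterm k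
  rw [Finset.sum_neg_distrib, ← Finset.mul_sum, Finset.sum_add_distrib] at h3
  nlinarith

theorem isClosed_weighted_coercive {E : Type*} [NormedAddCommGroup E] [InnerProductSpace ℂ E]
    (D : lp (fun _ : ℕ => E) 2 →L[ℂ] lp (fun _ : ℕ => E) 2)
    (c C : ℝ) (N : ℕ) :
    IsClosed {p : lp (fun _ : ℕ => E) 2 × lp (fun _ : ℕ => E) 2 |
      c * ‖D p.1‖ ^ 2 ≤ (⟪D p.2, D p.1⟫_ℂ).re + C * ∑ i ∈ Finset.range N, ‖(D p.1) i‖ ^ 2} := by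
  have hev (i : ℕ) : Continuous fun p : lp (fun _ : ℕ => E) 2 × lp (fun _ : ℕ => E) 2 =>
      (D p.1) i :=
    (lp.evalCLM ℂ (fun _ : ℕ => E) 2 i).continuous.comp (D.continuous.comp continuous_fst)
  have hin : Continuous fun p : lp (fun _ : ℕ => E) 2 × lp (fun _ : ℕ => E) 2 =>
      (⟪D p.2, D p.1⟫_ℂ).re :=
    Complex.continuous_re.comp ((D.continuous.comp continuous_snd).inner
      (D.continuous.comp continuous_fst))
  refine isClosed_le (by fun_prop) (hin.add (continuous_const.mul ?_))
  exact continuous_finsetSum _ fun i _ => (hev i).norm.pow 2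

/-- Conjugation by an admissible diagonal weight lowers the quadratic form of a block Jacobi
operator on finitely supported sequences by at most `s`. -/
theorem IsBlockJacobi.re_inner_weighted_ge {A B : ℕ → K →L[ℂ] K}
    {J : lp (fun _ : ℕ => K) 2 →ₗ.[ℂ] lp (fun _ : ℕ => K) 2} (hJ : IsBlockJacobi J A B)
    {w : ℕ → ℝ} (hw0 : ∀ n, 0 < w n) {s : ℝ} (hs : 0 ≤ s)
    (hw : ∀ k, (w (k + 1) - w k) ^ 2 * ‖A k‖ ≤ s * (w k * w (k + 1)))
    {D : lp (fun _ : ℕ => K) 2 →L[ℂ] lp (fun _ : ℕ => K) 2}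
    (hDa : ∀ (f : lp (fun _ : ℕ => K) 2) (n : ℕ), D f n = (w n : ℂ) • f n)
    {f : lp (fun _ : ℕ => K) 2} (hf : f ∈ J.domain) (hfin : IsFinSupp f) :
    ∃ hud : D f ∈ J.domain, (⟪J ⟨D f, hud⟩, D f⟫_ℂ).re - s * ‖D f‖ ^ 2 ≤
      (⟪D (J ⟨f, hf⟩), D f⟫_ℂ).re := by
  obtain ⟨M, hM⟩ := hfin.exists_forall_ge
  have hufin : IsFinSupp (D f) := by
    refine hfin.subset fun n hn hn' => hn ?_
    rw [hDa, hn', smul_zero]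
  have hud := hJ.dom_fin _ hufin
  refine ⟨hud, ?_⟩
  have hsum : (⟪D (J ⟨f, hf⟩) - J ⟨D f, hud⟩, D f⟫_ℂ).re =
      ∑ n ∈ Finset.range (M + 1), (⟪(w n : ℂ) • jacApply A B f n -
        jacApply A B (fun i => (w i : ℂ) • f i) n, (w n : ℂ) • f n⟫_ℂ).re := by
    rw [← Complex.re_sum]
    congr 1
    refine (lp.hasSum_inner (𝕜 := ℂ) _ _).unique ?_
    have e : (fun n => ⟪(D (J ⟨f, hf⟩) - J ⟨D f, hud⟩ : lp (fun _ : ℕ => K) 2) n, D f n⟫_ℂ) =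
        fun n => ⟪(w n : ℂ) • jacApply A B f n -
          jacApply A B (fun i => (w i : ℂ) • f i) n, (w n : ℂ) • f n⟫_ℂ := by
      funext n
      rw [lp.coeFn_sub, Pi.sub_apply, hDa, hDa, hJ.apply_fin _ hf hfin, hJ.apply_fin _ hud hufin]
      simp only [hDa]
    rw [e]
    refine hasSum_sum_of_ne_finset_zero fun n hn => ?_
    rw [hM n ((Nat.le_succ M).trans (not_lt.1 (mt Finset.mem_range.2 hn))), smul_zero,
      inner_zero_right]
  have h1 := neg_le_sum_re_inner_jacApply_weight_sub A B hw0 hs hw f M (hM _ (Nat.le_succ M))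
  rw [← hsum, inner_sub_left, Complex.sub_re] at h1
  have h2 := lp_sum_norm_sq_le (D f) (Finset.range (M + 1))
  simp only [hDa] at h2
  linarith [mul_le_mul_of_nonneg_left h2 hs]

/-- Coercivity of a weighted block Jacobi operator up to finitely many coordinates, given the
coercivity of the unweighted one. -/
theorem IsBlockJacobi.weighted_coercive {A B : ℕ → K →L[ℂ] K}
    {J : lp (fun _ : ℕ => K) 2 →ₗ.[ℂ] lp (fun _ : ℕ => K) 2} (hJ : IsBlockJacobi J A B)
    {c C : ℝ} {N : ℕ}
    (hcoer : ∀ u : J.domain, c * ‖(u : lp (fun _ : ℕ => K) 2)‖ ^ 2 ≤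
      (⟪J u, (u : lp (fun _ : ℕ => K) 2)⟫_ℂ).re +
        C * ∑ i ∈ Finset.range N, ‖(u : lp (fun _ : ℕ => K) 2) i‖ ^ 2)
    {w : ℕ → ℝ} (hw0 : ∀ n, 0 < w n) {s : ℝ} (hs : 0 ≤ s)
    (hw : ∀ k, (w (k + 1) - w k) ^ 2 * ‖A k‖ ≤ s * (w k * w (k + 1)))
    {D : lp (fun _ : ℕ => K) 2 →L[ℂ] lp (fun _ : ℕ => K) 2}
    (hDa : ∀ (f : lp (fun _ : ℕ => K) 2) (n : ℕ), D f n = (w n : ℂ) • f n) (v : J.domain) :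
    (c - s) * ‖D v‖ ^ 2 ≤ (⟪D (J v), D v⟫_ℂ).re + C * ∑ i ∈ Finset.range N, ‖(D v) i‖ ^ 2 := by
  suffices hsub : {p : lp (fun _ : ℕ => K) 2 × lp (fun _ : ℕ => K) 2 |
      ∃ h1 : p.1 ∈ J.domain, IsFinSupp p.1 ∧ J ⟨p.1, h1⟩ = p.2} ⊆ {p |
      (c - s) * ‖D p.1‖ ^ 2 ≤ (⟪D p.2, D p.1⟫_ℂ).re +
        C * ∑ i ∈ Finset.range N, ‖(D p.1) i‖ ^ 2} by
    have h := (isClosed_weighted_coercive D (c - s) C N).closure_subset_iff.2 hsub (hJ.isClosure v)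
    exact h
  rintro ⟨f, g⟩ ⟨hf, hfin, hfg⟩
  dsimp only at hf hfin hfg
  subst hfg
  obtain ⟨hud, h⟩ := hJ.re_inner_weighted_ge hw0 hs hw hDa hf hfin
  have h3 := hcoer ⟨D f, hud⟩
  rw [Set.mem_ofPred_eq, sub_mul]
  linarith

/-- Combes–Thomas bound for solutions of `(J - λ) v = e_j x`, for a weight which is at least one,
and equal to one near the origin and at the source. -/
theorem IsBlockJacobi.weighted_solution_bound {A B : ℕ → K →L[ℂ] K}
    {J : lp (fun _ : ℕ => K) 2 →ₗ.[ℂ] lp (fun _ : ℕ => K) 2} (hJ : IsBlockJacobi J A B)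
    {c C : ℝ} {N : ℕ} (hC : 0 ≤ C)
    (hcoer : ∀ u : J.domain, c * ‖(u : lp (fun _ : ℕ => K) 2)‖ ^ 2 ≤
      (⟪J u, (u : lp (fun _ : ℕ => K) 2)⟫_ℂ).re +
        C * ∑ i ∈ Finset.range N, ‖(u : lp (fun _ : ℕ => K) 2) i‖ ^ 2)
    {w : ℕ → ℝ} {L : ℕ} (hwL : ∀ n, L ≤ n → w n = w L)
    (hw0 : ∀ n, 0 < w n) {s : ℝ} (hs : 0 ≤ s)
    (hw : ∀ k, (w (k + 1) - w k) ^ 2 * ‖A k‖ ≤ s * (w k * w (k + 1)))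
    (hwN : ∀ n, n < N → w n = 1) {j : ℕ} (hwj : w j = 1)
    {lam : ℂ} {κ : ℝ} (hκ : 0 < κ) (hκ' : κ ≤ c - s - lam.re) {r : ℝ} {x : K} (v : J.domain)
    (hv : J v - lam • (v : lp (fun _ : ℕ => K) 2) = lp.single 2 j x)
    (hvr : ‖(v : lp (fun _ : ℕ => K) 2)‖ ≤ r * ‖x‖) (m : ℕ) :
    w m * ‖(v : lp (fun _ : ℕ => K) 2) m‖ ≤
      Real.sqrt (2 / κ * (1 / (2 * κ) + C * r ^ 2)) * ‖x‖ := by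
  obtain ⟨D, hD⟩ : ∃ D, D = diagCLM K w L := ⟨_, rfl⟩
  have hDa (f : lp (fun _ : ℕ => K) 2) (n : ℕ) : D f n = (w n : ℂ) • f n :=
    hD ▸ diagCLM_apply hwL f n
  have h := hJ.weighted_coercive hcoer hw0 hs hw hDa v
  have hDs : D (lp.single 2 j x) = lp.single 2 j x := by
    ext n
    rw [hDa]
    by_cases hn : n = j
    · rw [hn, hwj]; simp
    · rw [lp.single_apply_ne _ _ _ hn, smul_zero]
  have hJv : J v = lam • (v : lp (fun _ : ℕ => K) 2) + lp.single 2 j x := by rw [← hv]; abel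
  have hsum : ∑ i ∈ Finset.range N, ‖D (v : lp (fun _ : ℕ => K) 2) i‖ ^ 2 ≤ (r * ‖x‖) ^ 2 := by
    calc ∑ i ∈ Finset.range N, ‖D (v : lp (fun _ : ℕ => K) 2) i‖ ^ 2
        = ∑ i ∈ Finset.range N, ‖(v : lp (fun _ : ℕ => K) 2) i‖ ^ 2 := by
          refine Finset.sum_congr rfl fun i hi => ?_
          rw [hDa, hwN i (Finset.mem_range.1 hi)]; simp
      _ ≤ ‖(v : lp (fun _ : ℕ => K) 2)‖ ^ 2 := lp_sum_norm_sq_le _ _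
      _ ≤ (r * ‖x‖) ^ 2 := by gcongr
  rw [hJv, map_add, map_smul, hDs, inner_add_left, inner_smul_left, Complex.add_re,
    inner_self_eq_norm_sq_to_K] at h
  have e1 : ((starRingEnd ℂ) lam * ((‖D (v : lp (fun _ : ℕ => K) 2)‖ : ℝ) : ℂ) ^ 2).re =
      lam.re * ‖D (v : lp (fun _ : ℕ => K) 2)‖ ^ 2 := by
    rw [← Complex.ofReal_pow, Complex.re_mul_ofReal, Complex.conj_re]
  have e2 : (⟪lp.single 2 j x, D (v : lp (fun _ : ℕ => K) 2)⟫_ℂ).re ≤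
      ‖x‖ * ‖D (v : lp (fun _ : ℕ => K) 2)‖ := by
    have := (Complex.re_le_norm _).trans (norm_inner_le_norm (𝕜 := ℂ)
      (lp.single 2 j x) (D (v : lp (fun _ : ℕ => K) 2)))
    rwa [lp.norm_single (by norm_num)] at this
  erw [e1] at h
  set t := ‖D (v : lp (fun _ : ℕ => K) 2)‖ with ht
  have h5 : κ * t ^ 2 ≤ ‖x‖ * t + C * (r * ‖x‖) ^ 2 := by
    have a := mul_le_mul_of_nonneg_left hsum hC
    have b := mul_le_mul_of_nonneg_right hκ' (sq_nonneg t)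
    nlinarith
  have h6 : ‖x‖ * t ≤ κ / 2 * t ^ 2 + 1 / (2 * κ) * ‖x‖ ^ 2 := by
    have a : 0 ≤ (κ * t - ‖x‖) ^ 2 / (2 * κ) := by positivity
    have b : (κ * t - ‖x‖) ^ 2 / (2 * κ) = κ / 2 * t ^ 2 + 1 / (2 * κ) * ‖x‖ ^ 2 - ‖x‖ * t := by
      field_simp
      ring
    linarith
  have h7 : t ^ 2 ≤ (2 / κ * (1 / (2 * κ) + C * r ^ 2)) * ‖x‖ ^ 2 := by
    have a : κ / 2 * t ^ 2 ≤ (1 / (2 * κ) + C * r ^ 2) * ‖x‖ ^ 2 := by nlinarith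
    calc t ^ 2 = 2 / κ * (κ / 2 * t ^ 2) := by field_simp
      _ ≤ 2 / κ * ((1 / (2 * κ) + C * r ^ 2) * ‖x‖ ^ 2) := by gcongr
      _ = _ := by ring
  have h8 : t ≤ Real.sqrt (2 / κ * (1 / (2 * κ) + C * r ^ 2)) * ‖x‖ := by
    have := Real.sqrt_le_sqrt h7
    rwa [Real.sqrt_sq (norm_nonneg _), Real.sqrt_mul' _ (by positivity),
      Real.sqrt_sq (norm_nonneg _)] at this
  refine le_trans ?_ h8
  have := lp.norm_apply_le_norm (by norm_num) (D (v : lp (fun _ : ℕ => K) 2)) m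
  rwa [hDa, norm_smul, Complex.norm_of_nonneg (hw0 m).le] at this

/-- The increment `γ / √a` of the exponent is admissible once `a` is large. -/
theorem exp_weight_increment_bound {ε β a t p q : ℝ} (hε : 0 < ε) (hε1 : ε < 1) (hβ : 0 < β)
    (ha : 0 < a) (ha' : β / (2 * ε) ≤ a) (ht : t = (1 - ε) * Real.sqrt β * (1 / Real.sqrt a))
    (hp : 0 < p) (hq : q = p * Real.exp t) :
    (q - p) ^ 2 * a ≤ (1 - ε) * β * (p * q) := by
  have hcosh : (q - p) ^ 2 = (2 * Real.cosh t - 2) * (p * q) := by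
    have e : Real.exp t * Real.exp (-t) = 1 := by rw [← Real.exp_add]; simp
    rw [hq, Real.cosh_eq]
    linear_combination (-p ^ 2) * e
  have hq0 : 0 < q := by rw [hq]; positivity
  have ht2 : t ^ 2 / 2 * (2 * a) = (1 - ε) ^ 2 * β := by
    rw [ht, mul_pow, mul_pow, div_pow, Real.sq_sqrt hβ.le, Real.sq_sqrt ha.le]
    field_simp
  have hy0 : 0 ≤ t ^ 2 / 2 := by positivity
  have hye : t ^ 2 / 2 ≤ ε := by
    rw [div_le_iff₀ (by positivity)] at ha'
    have : t ^ 2 / 2 * (2 * a) ≤ ε * (2 * a) := by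
      have : (1 - ε) ^ 2 ≤ 1 := by nlinarith
      rw [ht2]; nlinarith
    exact le_of_mul_le_mul_right this (by positivity)
  have h1 := Real.cosh_le_exp_half_sq t
  have h2 := (abs_le.1 (Real.abs_exp_sub_one_sub_id_le (x := t ^ 2 / 2)
    (by rw [abs_of_nonneg hy0]; linarith))).2
  have h3 : (2 * Real.cosh t - 2) * a ≤ (1 - ε) * β := by
    set y := t ^ 2 / 2 with hy
    have : (2 * Real.cosh t - 2) * a ≤ (y * (2 * a)) * (1 + y) := by nlinarith
    rw [ht2] at this
    have h4 : (1 - ε) ^ 2 * β * (1 + y) ≤ (1 - ε) ^ 2 * β * (1 + ε) := by gcongr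
    have h5 : 0 ≤ (1 - ε) * β * ε ^ 2 := by
      have : 0 < 1 - ε := by linarith
      positivity
    nlinarith
  rw [hcosh]
  nlinarith [mul_le_mul_of_nonneg_right h3 (mul_pos hp hq0).le]

/-- Decay to the right of the source, uniformly over all `λ` with given real part. -/
theorem IsBlockJacobi.solution_decay {A B : ℕ → K →L[ℂ] K}
    {J : lp (fun _ : ℕ => K) 2 →ₗ.[ℂ] lp (fun _ : ℕ => K) 2} (hJ : IsBlockJacobi J A B)
    (hA : Filter.Tendsto (fun k => ‖A k‖) Filter.atTop Filter.atTop)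
    {b : ℝ} (hess : EssSpecFrom J b) {ε : ℝ} (hε : ε ∈ Set.Ioo (0 : ℝ) 1)
    {μ : ℝ} (hμ : μ < b) (r : ℝ) :
    ∃ C : ℝ, 0 ≤ C ∧ ∀ (lam : ℂ) (m j : ℕ) (x : K) (v : J.domain), lam.re = μ → j ≤ m →
      J v - lam • (v : lp (fun _ : ℕ => K) 2) = lp.single 2 j x →
      ‖(v : lp (fun _ : ℕ => K) 2)‖ ≤ r * ‖x‖ →
      ‖(v : lp (fun _ : ℕ => K) 2) m‖ ≤ C * Real.exp (-((1 - ε) * Real.sqrt (b - μ)) *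
        ∑ k ∈ Finset.Ico j m, 1 / Real.sqrt ‖A k‖) * ‖x‖ := by
  obtain ⟨hε0, hε1⟩ := hε
  have hβ : 0 < b - μ := sub_pos.2 hμ
  obtain ⟨K₀, hK₀, -, hK₀b⟩ := hess
  obtain ⟨N₀, C₀, hC₀, hK⟩ := hK₀.exists_neg_le_re_inner
    (show 0 < ε * (b - μ) / 2 by positivity)
  obtain ⟨N₁, hN₁⟩ := Filter.eventually_atTop.1
    (hA.eventually_ge_atTop (max 1 ((b - μ) / (2 * ε))))
  have hcoer (u : J.domain) : (b - ε * (b - μ) / 2) * ‖(u : lp (fun _ : ℕ => K) 2)‖ ^ 2 ≤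
      (⟪J u, (u : lp (fun _ : ℕ => K) 2)⟫_ℂ).re +
        C₀ * ∑ i ∈ Finset.range N₀, ‖(u : lp (fun _ : ℕ => K) 2) i‖ ^ 2 := by
    have h1 := hK u
    have h2 := hK₀b u
    rw [inner_sub_left, Complex.sub_re] at h2
    linarith
  set N := max N₀ N₁ with hN
  set γ := (1 - ε) * Real.sqrt (b - μ) with hγ
  have hγ0 : 0 ≤ γ := mul_nonneg (by linarith) (Real.sqrt_nonneg _)
  set κ := ε * (b - μ) / 2 with hκ
  set C₁ := Real.sqrt (2 / κ * (1 / (2 * κ) + C₀ * r ^ 2)) with hC₁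
  refine ⟨C₁ * Real.exp (γ * ∑ k ∈ Finset.range N, 1 / Real.sqrt ‖A k‖),
    mul_nonneg (Real.sqrt_nonneg _) (Real.exp_pos _).le, fun lam m j x v hlam hjm hv hvr => ?_⟩
  let S : Finset ℕ := (Finset.Ico j m).filter (N ≤ ·)
  let d : ℕ → ℝ := fun k => if k ∈ S then γ * (1 / Real.sqrt ‖A k‖) else 0
  let w : ℕ → ℝ := fun n => Real.exp (∑ k ∈ Finset.range n, d k)
  have hS {k : ℕ} : k ∈ S ↔ (j ≤ k ∧ k < m) ∧ N ≤ k := by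
    rw [Finset.mem_filter, Finset.mem_Ico]
  have hw0 (n : ℕ) : 0 < w n := Real.exp_pos _
  have hw1 {n : ℕ} (hn : ∀ k < n, k ∉ S) : w n = 1 := by
    have : ∑ k ∈ Finset.range n, d k = 0 :=
      Finset.sum_eq_zero fun k hk => if_neg (hn k (Finset.mem_range.1 hk))
    simp [w, this]
  have hwm (n : ℕ) (hn : m ≤ n) : w n = w m := by
    have : ∑ k ∈ Finset.range m, d k = ∑ k ∈ Finset.range n, d k := by
      refine Finset.sum_subset (Finset.range_mono hn) fun k _ hk => if_neg fun h => ?_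
      exact hk (Finset.mem_range.2 (hS.1 h).1.2)
    simp [w, this]
  have hwsucc (k : ℕ) : w (k + 1) = w k * Real.exp (d k) := by
    simp only [w]
    rw [Finset.sum_range_succ, Real.exp_add]
  have hw (k : ℕ) : (w (k + 1) - w k) ^ 2 * ‖A k‖ ≤
      (1 - ε) * (b - μ) * (w k * w (k + 1)) := by
    by_cases hk : k ∈ S
    · have h := hN₁ k ((le_max_right _ _).trans (hS.1 hk).2)
      exact exp_weight_increment_bound hε0 hε1 hβ
        (one_pos.trans_le ((le_max_left _ _).trans h)) ((le_max_right _ _).trans h)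
        (if_pos hk) (hw0 k) (hwsucc k)
    · have : w (k + 1) = w k := by rw [hwsucc]; simp [d, hk]
      rw [this, sub_self, zero_pow two_ne_zero, zero_mul]
      have := hw0 k
      have : 0 < 1 - ε := by linarith
      positivity
  have hmain := hJ.weighted_solution_bound hC₀ hcoer hwm hw0
    (mul_nonneg (by linarith) hβ.le) hw
    (fun n hn => hw1 fun k hk hkS => by
      have := (hS.1 hkS).2
      have := le_max_left N₀ N₁
      omega)
    (hw1 fun k hk hkS => by
      have := (hS.1 hkS).1.1
      omega)
    (show 0 < κ by positivity) (by rw [hlam, hκ]; nlinarith) v hv hvr m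
  have hexp : γ * ∑ k ∈ Finset.Ico j m, 1 / Real.sqrt ‖A k‖ ≤
      ∑ k ∈ Finset.range m, d k + γ * ∑ k ∈ Finset.range N, 1 / Real.sqrt ‖A k‖ := by
    have e1 : ∑ k ∈ Finset.range m, d k = γ * ∑ k ∈ S, 1 / Real.sqrt ‖A k‖ := by
      rw [Finset.mul_sum, Finset.sum_ite_mem]
      refine Finset.sum_congr (Finset.inter_eq_right.2 fun k hk => ?_) fun _ _ => rfl
      exact Finset.mem_range.2 (hS.1 hk).1.2
    have e2 : ∑ k ∈ (Finset.Ico j m).filter (¬ N ≤ ·), 1 / Real.sqrt ‖A k‖ ≤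
        ∑ k ∈ Finset.range N, 1 / Real.sqrt ‖A k‖ := by
      refine Finset.sum_le_sum_of_subset_of_nonneg (fun k hk => ?_) fun _ _ _ => by positivity
      exact Finset.mem_range.2 (not_le.1 (Finset.mem_filter.1 hk).2)
    rw [e1, ← mul_add, ← Finset.sum_filter_add_sum_filter_not (Finset.Ico j m) (N ≤ ·)]
    exact mul_le_mul_of_nonneg_left (add_le_add le_rfl e2) hγ0
  have hone : 1 ≤ Real.exp (γ * ∑ k ∈ Finset.range N, 1 / Real.sqrt ‖A k‖) *
      Real.exp (-γ * ∑ k ∈ Finset.Ico j m, 1 / Real.sqrt ‖A k‖) * w m := by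
    rw [← Real.exp_add, ← Real.exp_add, Real.one_le_exp_iff]
    linarith
  calc ‖(v : lp (fun _ : ℕ => K) 2) m‖
      ≤ Real.exp (γ * ∑ k ∈ Finset.range N, 1 / Real.sqrt ‖A k‖) *
        Real.exp (-γ * ∑ k ∈ Finset.Ico j m, 1 / Real.sqrt ‖A k‖) * w m *
          ‖(v : lp (fun _ : ℕ => K) 2) m‖ := le_mul_of_one_le_left (norm_nonneg _) hone
    _ = Real.exp (γ * ∑ k ∈ Finset.range N, 1 / Real.sqrt ‖A k‖) *
        Real.exp (-γ * ∑ k ∈ Finset.Ico j m, 1 / Real.sqrt ‖A k‖) *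
          (w m * ‖(v : lp (fun _ : ℕ => K) 2) m‖) := by ring
    _ ≤ Real.exp (γ * ∑ k ∈ Finset.range N, 1 / Real.sqrt ‖A k‖) *
        Real.exp (-γ * ∑ k ∈ Finset.Ico j m, 1 / Real.sqrt ‖A k‖) * (C₁ * ‖x‖) := by gcongr
    _ = _ := by ring

/-- The adjoint of the resolvent of a self-adjoint operator at `λ` is a right inverse of
`J - conj λ`. -/
theorem IsResolventAt.adjoint_right_inverse
    {J : lp (fun _ : ℕ => K) 2 →ₗ.[ℂ] lp (fun _ : ℕ => K) 2} (hsa : IsSelfAdjoint J) {lam : ℂ}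
    {R : lp (fun _ : ℕ => K) 2 →L[ℂ] lp (fun _ : ℕ => K) 2} (hR : IsResolventAt J lam R)
    (v : lp (fun _ : ℕ => K) 2) :
    ∃ hv : ContinuousLinearMap.adjoint R v ∈ J.domain,
      J ⟨ContinuousLinearMap.adjoint R v, hv⟩ -
        (starRingEnd ℂ) lam • (ContinuousLinearMap.adjoint R v) = v := by
  have key (u : J.domain) : ⟪v + (starRingEnd ℂ) lam • ContinuousLinearMap.adjoint R v,
      (u : lp (fun _ : ℕ => K) 2)⟫_ℂ = ⟪ContinuousLinearMap.adjoint R v, J u⟫_ℂ := by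
    have h : ⟪ContinuousLinearMap.adjoint R v, J u - lam • (u : lp (fun _ : ℕ => K) 2)⟫_ℂ =
        ⟪v, (u : lp (fun _ : ℕ => K) 2)⟫_ℂ := by
      rw [ContinuousLinearMap.adjoint_inner_left, hR.1 u]
    rw [inner_sub_right, inner_smul_right] at h
    rw [inner_add_left, inner_smul_left, Complex.conj_conj, ← h]
    ring
  have hadj := LinearPMap.isSelfAdjoint_def.1 hsa
  have hmem := LinearPMap.mem_adjoint_domain_of_exists (T := J) _ ⟨_, key⟩
  have happ := LinearPMap.adjoint_apply_eq hsa.dense_domain ⟨_, hmem⟩ key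
  generalize ContinuousLinearMap.adjoint R v = z at *
  revert hmem
  rw [hadj]
  intro hmem happ
  exact ⟨hmem, by rw [happ]; abel⟩

end WeightedEstimates

/-- **Corollary 3.4(a).** Green matrix decay when `‖A_k‖ → ∞`. -/
theorem green_matrix_decay_norm_tendsto_atTop
    (A B : ℕ → K →L[ℂ] K) (hB : ∀ n, IsSelfAdjoint (B n))
    (J : lp (fun _ : ℕ => K) 2 →ₗ.[ℂ] lp (fun _ : ℕ => K) 2)
    (hJ : IsBlockJacobi J A B) (hsa : IsSelfAdjoint J)
    (hbelow : IsBoundedBelowOp J)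
    (hA : Filter.Tendsto (fun k => ‖A k‖) Filter.atTop Filter.atTop)
    (b : ℝ) (hess : EssSpecFrom J b)
    (ε : ℝ) (hε : ε ∈ Set.Ioo (0 : ℝ) 1)
    (lam : ℂ) (hlam : lam.re < b)
    (R : lp (fun _ : ℕ => K) 2 →L[ℂ] lp (fun _ : ℕ => K) 2)
    (hR : IsResolventAt J lam R) :
    ∃ C : ℝ, ∀ m j : ℕ, ∀ x : K,
      ‖(R (lp.single 2 j x)) m‖ ≤
        C * Real.exp (-((1 - ε) * Real.sqrt (b - lam.re)) *
            ∑ k ∈ Finset.Ico (min m j) (max m j), 1 / Real.sqrt ‖A k‖) * ‖x‖ := by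
  obtain ⟨C, hC0, hC⟩ := hJ.solution_decay hA hess hε hlam ‖R‖
  refine ⟨C, fun m j x => ?_⟩
  rcases le_total j m with hjm | hmj
  · rw [min_eq_right hjm, max_eq_left hjm]
    obtain ⟨hv, hv'⟩ := hR.2 (lp.single 2 j x)
    refine hC lam m j x ⟨_, hv⟩ rfl hjm hv' ?_
    have := R.le_opNorm (lp.single 2 j x)
    rwa [lp.norm_single (by norm_num)] at this
  · rw [min_eq_left hmj, max_eq_right hmj]
    set y := (R (lp.single 2 j x)) m with hy
    obtain ⟨hv, hv'⟩ := hR.adjoint_right_inverse hsa (lp.single 2 m y)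
    have hdec := hC ((starRingEnd ℂ) lam) j m y ⟨_, hv⟩ (Complex.conj_re _) hmj hv' (by
      have := (ContinuousLinearMap.adjoint R).le_opNorm (lp.single 2 m y)
      rwa [lp.norm_single (by norm_num), LinearIsometryEquiv.norm_map] at this)
    dsimp only at hdec
    set E := Real.exp (-((1 - ε) * Real.sqrt (b - lam.re)) *
      ∑ k ∈ Finset.Ico m j, 1 / Real.sqrt ‖A k‖)
    have e : ⟪y, y⟫_ℂ = ⟪ContinuousLinearMap.adjoint R (lp.single 2 m y) j, x⟫_ℂ :=
      (lp.inner_single_left (𝕜 := ℂ) m y (R (lp.single 2 j x))).symm.trans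
        ((ContinuousLinearMap.adjoint_inner_left R _ _).symm.trans
          (lp.inner_single_right (𝕜 := ℂ) (G := fun _ : ℕ => K) j x
            (ContinuousLinearMap.adjoint R (lp.single 2 m y))))
    have h1 : ‖y‖ * ‖y‖ ≤ C * E * ‖x‖ * ‖y‖ := by
      have a : ‖y‖ * ‖y‖ ≤ ‖ContinuousLinearMap.adjoint R (lp.single 2 m y) j‖ * ‖x‖ := by
        rw [← inner_self_eq_norm_mul_norm (𝕜 := ℂ) y, e]
        exact (Complex.re_le_norm _).trans (norm_inner_le_norm _ _)
      have b := mul_le_mul_of_nonneg_right hdec (norm_nonneg x)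
      linarith
    rcases (norm_nonneg y).eq_or_lt with h0 | h0
    · rw [← h0]
      positivity
    · exact le_of_mul_le_mul_right h1 h0
end
end
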